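/- arXiv:1803.03060 — 6 statements merged into one kernel-verified Lean document; each statement's English description precedes it below -/
import Mathlib

section
/- There exists a constant δ > 0 such that for all sufficiently large k, every hypergraph H with s_min(H) ≥ k and q(H) ≤ δ·log k is two colorable. -/
open Finset

/-- `q(H) = ∑_{f ∈ E} 2^{-|f|+1}`: the expected number of monochromatic edges under a
uniformly random two coloring. -/
noncomputable def qH {V : Type} (E : Finset (Finset V)) : ℝ :=
  ∑ f ∈ E, (2 : ℝ) ^ (1 - (f.card : ℤ))

/-- `H = (V, E)` is two colorable: there is a blue/red coloring of the vertices such that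
every edge contains a blue vertex and a red vertex (blue = `true`, red = `false`). -/
def TwoColorable {V : Type} (E : Finset (Finset V)) : Prop :=
  ∃ c : V → Bool, ∀ f ∈ E, (∃ v ∈ f, c v = true) ∧ (∃ v ∈ f, c v = false)

section Potential

variable {V : Type}

/-- The expected number of monochromatic edges when each vertex `v` is independently red with
probability `p v`. -/
noncomputable def totalWeight (E : Finset (Finset V)) (p : V → ℝ) : ℝ :=
  ∑ e ∈ E, (∏ v ∈ e, p v + ∏ v ∈ e, (1 - p) v)

open Classical in
/-- The total weight of the pairs of edges related by `P` that can still become monochromatic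
in opposite colors. -/
noncomputable def conflictWeight (E : Finset (Finset V)) (P : Finset V → Finset V → Prop)
    (p : V → ℝ) : ℝ :=
  ∑ e ∈ E, ∑ f ∈ E, if P e f then
    (∏ v ∈ e, p v) * (∏ v ∈ f, (1 - p) v) + (∏ v ∈ e, (1 - p) v) * (∏ v ∈ f, p v) else 0

/-- The edges `e` and `f` meet exactly in the last vertex of `e`, with respect to the rank `ρ`. -/
def MeetAtLast (ρ : V → ℕ) (e f : Finset V) : Prop :=
  ∃ v, (∀ u, u ∈ e ∧ u ∈ f ↔ u = v) ∧ ∀ u ∈ e, ρ u ≤ ρ v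

/-- The vertices of rank below `i` are colored (`1` is red and `0` is blue) and the others are
still undecided. -/
def IsPartialColoring (ρ : V → ℕ) (i : ℕ) (p : V → ℝ) : Prop :=
  ∀ v, (ρ v < i → p v = 0 ∨ p v = 1) ∧ (i ≤ ρ v → p v = 1 / 2)

/-- No edge is entirely colored with a single color. -/
def NoMono (E : Finset (Finset V)) (p : V → ℝ) : Prop :=
  ∀ e ∈ E, (∃ v ∈ e, p v ≠ 1) ∧ (∃ v ∈ e, p v ≠ 0)

theorem totalWeight_one_sub (E : Finset (Finset V)) (p : V → ℝ) :
    totalWeight E (1 - p) = totalWeight E p := by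
  simp only [totalWeight, sub_sub_cancel]
  exact sum_congr rfl fun e _ => add_comm _ _

theorem conflictWeight_one_sub (E : Finset (Finset V)) (P : Finset V → Finset V → Prop)
    (p : V → ℝ) : conflictWeight E P (1 - p) = conflictWeight E P p := by
  simp only [conflictWeight, sub_sub_cancel]
  refine sum_congr rfl fun e _ => sum_congr rfl fun f _ => ?_
  split_ifs
  · exact add_comm _ _
  · rfl

theorem NoMono.one_sub {E : Finset (Finset V)} {p : V → ℝ} (h : NoMono E p) :
    NoMono E (1 - p) := by
  intro e he
  obtain ⟨⟨u, hu, hu'⟩, w, hw, hw'⟩ := h e he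
  refine ⟨⟨w, hw, ?_⟩, u, hu, ?_⟩
  · simpa using hw'
  · simpa [sub_eq_zero] using hu'.symm

theorem IsPartialColoring.one_sub {ρ : V → ℕ} {i : ℕ} {p : V → ℝ}
    (h : IsPartialColoring ρ i p) : IsPartialColoring ρ i (1 - p) := by
  intro v
  refine ⟨fun hv => ?_, fun hv => ?_⟩
  · rcases (h v).1 hv with h0 | h0 <;> simp [h0]
  · simp only [Pi.sub_apply, Pi.one_apply, (h v).2 hv]
    norm_num

theorem IsPartialColoring.nonneg {ρ : V → ℕ} {i : ℕ} {p : V → ℝ}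
    (h : IsPartialColoring ρ i p) (v : V) : 0 ≤ p v := by
  rcases lt_or_ge (ρ v) i with hv | hv
  · rcases (h v).1 hv with h0 | h0 <;> simp [h0]
  · simp [(h v).2 hv]

theorem IsPartialColoring.prod_nonneg {ρ : V → ℕ} {i : ℕ} {p : V → ℝ}
    (h : IsPartialColoring ρ i p) (e : Finset V) : 0 ≤ ∏ v ∈ e, p v :=
  Finset.prod_nonneg fun v _ => h.nonneg v

theorem IsPartialColoring.totalWeight_nonneg {ρ : V → ℕ} {i : ℕ} {p : V → ℝ}
    (h : IsPartialColoring ρ i p) (E : Finset (Finset V)) : 0 ≤ totalWeight E p :=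
  sum_nonneg fun e _ => add_nonneg (h.prod_nonneg e) (h.one_sub.prod_nonneg e)

theorem IsPartialColoring.conflict_nonneg {ρ : V → ℕ} {i : ℕ} {p : V → ℝ}
    (h : IsPartialColoring ρ i p) (e f : Finset V) :
    0 ≤ (∏ v ∈ e, p v) * (∏ v ∈ f, (1 - p) v) + (∏ v ∈ e, (1 - p) v) * (∏ v ∈ f, p v) :=
  add_nonneg (mul_nonneg (h.prod_nonneg e) (h.one_sub.prod_nonneg f))
    (mul_nonneg (h.one_sub.prod_nonneg e) (h.prod_nonneg f))

theorem IsPartialColoring.conflictWeight_nonneg {ρ : V → ℕ} {i : ℕ} {p : V → ℝ}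
    (h : IsPartialColoring ρ i p) (E : Finset (Finset V)) (P : Finset V → Finset V → Prop) :
    0 ≤ conflictWeight E P p := by
  refine sum_nonneg fun e _ => sum_nonneg fun f _ => ?_
  split_ifs
  · exact h.conflict_nonneg e f
  · exact le_rfl

theorem totalWeight_half (E : Finset (Finset V)) :
    totalWeight E (fun _ => 1 / 2) = qH E := by
  refine sum_congr rfl fun e _ => ?_
  have : ((1 : V → ℝ) - fun _ => 1 / 2) = fun _ => 1 / 2 := by ext; norm_num
  rw [this, prod_const, zpow_sub₀ two_ne_zero, zpow_natCast]
  simp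
  ring

open Classical in
theorem conflictWeight_half (E : Finset (Finset V)) (P : Finset V → Finset V → Prop) :
    conflictWeight E P (fun _ => 1 / 2) =
      ∑ e ∈ E, ∑ f ∈ E, (2 : ℝ) ^ (1 - (e.card : ℤ)) * (2 : ℝ) ^ (1 - (f.card : ℤ)) / 2 *
        (if P e f then 1 else 0) := by
  refine sum_congr rfl fun e _ => sum_congr rfl fun f _ => ?_
  have : ((1 : V → ℝ) - fun _ => 1 / 2) = fun _ => 1 / 2 := by ext; norm_num
  rw [this]
  split_ifs
  · simp only [prod_const, zpow_sub₀ (two_ne_zero' ℝ), zpow_natCast]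
    simp
    ring
  · simp

variable [DecidableEq V]

theorem one_sub_update (p : V → ℝ) (v : V) (a : ℝ) :
    1 - Function.update p v a = Function.update (1 - p) v (1 - a) := by
  ext u
  by_cases h : u = v
  · subst h; simp
  · simp [h]

theorem prod_update_of_half {p : V → ℝ} {v : V} (hv : p v = 1 / 2) (a : ℝ) (e : Finset V) :
    ∏ u ∈ e, Function.update p v a u = (if v ∈ e then 2 * a else 1) * ∏ u ∈ e, p u := by
  split_ifs with h
  · rw [prod_update_of_mem h, ← prod_sdiff (singleton_subset_iff.2 h)]
    simp [hv]
    ring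
  · rw [prod_update_of_notMem h, one_mul]

theorem IsPartialColoring.update {ρ : V → ℕ} {i : ℕ} {p : V → ℝ}
    (h : IsPartialColoring ρ i p) (hρ : Function.Injective ρ) {v : V} (hv : ρ v = i) {a : ℝ}
    (ha : a = 0 ∨ a = 1) : IsPartialColoring ρ (i + 1) (Function.update p v a) := by
  intro u
  by_cases huv : u = v
  · subst huv
    simp only [Function.update_self]
    exact ⟨fun _ => ha, fun hu => by omega⟩
  · have : ρ u ≠ ρ v := fun h => huv (hρ h)
    rw [Function.update_of_ne huv]
    exact ⟨fun hu => (h u).1 (by omega), fun hu => (h u).2 (by omega)⟩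

theorem totalWeight_update_add (E : Finset (Finset V)) {p : V → ℝ} {v : V}
    (hv : p v = 1 / 2) :
    totalWeight E (Function.update p v 0) + totalWeight E (Function.update p v 1) =
      2 * totalWeight E p := by
  have hv' : (1 - p) v = 1 / 2 := by simp [hv]; norm_num
  simp only [totalWeight, one_sub_update, prod_update_of_half hv, prod_update_of_half hv']
  rw [← sum_add_distrib, mul_sum]
  refine sum_congr rfl fun e _ => ?_
  split_ifs <;> ring

theorem conflictWeight_update_add_le (E : Finset (Finset V)) (P : Finset V → Finset V → Prop)
    {ρ : V → ℕ} {i : ℕ} {p : V → ℝ} (h : IsPartialColoring ρ i p) {v : V} (hv : p v = 1 / 2) :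
    conflictWeight E P (Function.update p v 0) + conflictWeight E P (Function.update p v 1) ≤
      2 * conflictWeight E P p := by
  have hv' : (1 - p) v = 1 / 2 := by simp [hv]; norm_num
  simp only [conflictWeight, one_sub_update, prod_update_of_half hv, prod_update_of_half hv']
  rw [← sum_add_distrib, mul_sum]
  refine sum_le_sum fun e _ => ?_
  rw [← sum_add_distrib, mul_sum]
  refine sum_le_sum fun f _ => ?_
  have := h.conflict_nonneg e f
  split_ifs <;> linarith

theorem conflictWeight_update_zero_le (E : Finset (Finset V))
    (P : Finset V → Finset V → Prop) {ρ : V → ℕ} {i : ℕ} {p : V → ℝ}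
    (h : IsPartialColoring ρ i p) {v : V} (hv : p v = 1 / 2) :
    conflictWeight E P (Function.update p v 0) ≤ 2 * conflictWeight E P p := by
  have hv' : (1 - p) v = 1 / 2 := by simp [hv]; norm_num
  simp only [conflictWeight, one_sub_update, prod_update_of_half hv, prod_update_of_half hv']
  rw [mul_sum]
  refine sum_le_sum fun e _ => ?_
  rw [mul_sum]
  refine sum_le_sum fun f _ => ?_
  have h1 := mul_nonneg (h.prod_nonneg e) (h.one_sub.prod_nonneg f)
  have h2 := mul_nonneg (h.one_sub.prod_nonneg e) (h.prod_nonneg f)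
  split_ifs <;> linarith

/-- If coloring `v` red would complete the red edge `e`, then the edges through `v` that may
still become blue have small weight. -/
theorem sum_blue_le_conflictWeight {E : Finset (Finset V)} {ρ : V → ℕ} {i : ℕ} {p : V → ℝ}
    (h : IsPartialColoring ρ i p) {v : V} (hv : ρ v = i) {e : Finset V} (he : e ∈ E)
    (hve : v ∈ e) (hred : ∀ u ∈ e, u ≠ v → p u = 1) :
    ∑ f ∈ E, (if v ∈ f then ∏ u ∈ f, (1 - p) u else 0) ≤
      2 * conflictWeight E (MeetAtLast ρ) p := by
  have hprod : ∏ u ∈ e, p u = 1 / 2 := by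
    rw [prod_eq_single_of_mem v hve hred, (h v).2 hv.ge]
  have hterm : ∀ f ∈ E, (if v ∈ f then ∏ u ∈ f, (1 - p) u else 0) ≤
      2 * (open Classical in if MeetAtLast ρ e f then
        (∏ v ∈ e, p v) * (∏ v ∈ f, (1 - p) v) + (∏ v ∈ e, (1 - p) v) * (∏ v ∈ f, p v) else 0) := by
    intro f _
    have hnn := mul_nonneg (h.one_sub.prod_nonneg e) (h.prod_nonneg f)
    have hnn' := h.one_sub.prod_nonneg f
    by_cases hvf : v ∈ f
    · by_cases hdisj : ∃ u ∈ e, u ∈ f ∧ u ≠ v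
      · obtain ⟨u, hue, huf, huv⟩ := hdisj
        have : ∏ u ∈ f, (1 - p) u = 0 := prod_eq_zero huf (by simp [hred u hue huv])
        rw [if_pos hvf, this]
        split_ifs <;> linarith
      · push Not at hdisj
        have hm : MeetAtLast ρ e f := by
          refine ⟨v, fun u => ⟨fun hu => hdisj u hu.1 hu.2, ?_⟩, fun u hu => ?_⟩
          · rintro rfl
            exact ⟨hve, hvf⟩
          · by_cases huv : u = v
            · rw [huv]
            · by_contra! hlt
              have h1 := (h u).2 (by omega)
              rw [hred u hu huv] at h1
              norm_num at h1
        rw [if_pos hvf, if_pos hm, hprod]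
        linarith
    · rw [if_neg hvf]
      have := mul_nonneg (h.prod_nonneg e) hnn'
      split_ifs <;> linarith
  refine (sum_le_sum hterm).trans ?_
  rw [← mul_sum]
  refine mul_le_mul_of_nonneg_left ?_ zero_le_two
  refine single_le_sum (f := fun e => ∑ f ∈ E, (open Classical in if MeetAtLast ρ e f then
        (∏ v ∈ e, p v) * (∏ v ∈ f, (1 - p) v) + (∏ v ∈ e, (1 - p) v) * (∏ v ∈ f, p v) else 0))
    (fun e _ => sum_nonneg fun f _ => ?_) he
  split_ifs
  · exact h.conflict_nonneg e f
  · exact le_rfl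

theorem exists_red_update_zero {E : Finset (Finset V)} {p : V → ℝ} (hE : NoMono E p) (v : V) :
    ∀ f ∈ E, ∃ u ∈ f, Function.update p v 0 u ≠ 1 := by
  intro f hf
  obtain ⟨u, hu, hu'⟩ := (hE f hf).1
  refine ⟨u, hu, ?_⟩
  by_cases huv : u = v
  · subst huv; simp
  · rwa [Function.update_of_ne huv]

/-- A vertex whose red coloring would complete a red edge can be colored blue. -/
theorem forced_step {E : Finset (Finset V)} {ρ : V → ℕ} (hρ : Function.Injective ρ) {i : ℕ}
    {p : V → ℝ} (h : IsPartialColoring ρ i p) (hE : NoMono E p)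
    (hpot : conflictWeight E (MeetAtLast ρ) p * (16 : ℝ) ^ totalWeight E p < 1 / 8)
    {v : V} (hv : ρ v = i)
    (hforced : ∃ e ∈ E, ∀ u ∈ e, Function.update p v 1 u = 1) :
    ∃ q, IsPartialColoring ρ (i + 1) q ∧ NoMono E q ∧
      conflictWeight E (MeetAtLast ρ) q * (16 : ℝ) ^ totalWeight E q < 1 / 8 := by
  obtain ⟨e, he, hall⟩ := hforced
  have hhalf : p v = 1 / 2 := (h v).2 hv.ge
  have hhalf' : (1 - p) v = 1 / 2 := by simp [hhalf]; norm_num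
  have hred : ∀ u ∈ e, u ≠ v → p u = 1 := fun u hu huv => by
    simpa [Function.update_of_ne huv] using hall u hu
  have hve : v ∈ e := by
    by_contra hve
    obtain ⟨u, hu, hu'⟩ := (hE e he).1
    exact hu' (hred u hu fun huv => hve (huv ▸ hu))
  have hD0 := h.conflictWeight_nonneg E (MeetAtLast ρ)
  have hD : conflictWeight E (MeetAtLast ρ) p < 1 / 8 := by
    refine lt_of_le_of_lt (le_mul_of_one_le_right hD0 ?_) hpot
    exact Real.one_le_rpow (by norm_num) (h.totalWeight_nonneg E)
  have hblue := sum_blue_le_conflictWeight h hv he hve hred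
  have hstate := h.update hρ hv (a := 0) (Or.inl rfl)
  refine ⟨_, hstate, fun f hf => ⟨exists_red_update_zero hE v f hf, ?_⟩, ?_⟩
  · by_contra! hf0
    have hblue0 : ∀ u ∈ f, u ≠ v → p u = 0 := fun u hu huv => by
      simpa [Function.update_of_ne huv] using hf0 u hu
    have hvf : v ∈ f := by
      by_contra hvf
      obtain ⟨u, hu, hu'⟩ := (hE f hf).2
      exact hu' (hblue0 u hu fun huv => hvf (huv ▸ hu))
    have hprod : ∏ u ∈ f, (1 - p) u = 1 / 2 := by
      rw [prod_eq_single_of_mem v hvf (fun u hu huv => by simp [hblue0 u hu huv]), hhalf']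
    have := single_le_sum (f := fun f => if v ∈ f then ∏ u ∈ f, (1 - p) u else 0)
      (fun f _ => by
        split_ifs
        · exact h.one_sub.prod_nonneg f
        · exact le_rfl) hf
    simp only [if_pos hvf, hprod] at this
    linarith
  · have hW : totalWeight E (Function.update p v 0) ≤ totalWeight E p - 1 / 4 := by
      have hsplit : totalWeight E (Function.update p v 0) = totalWeight E p
          - ∑ f ∈ E, (if v ∈ f then ∏ u ∈ f, p u else 0)
          + ∑ f ∈ E, (if v ∈ f then ∏ u ∈ f, (1 - p) u else 0) := by
        simp only [totalWeight, one_sub_update, prod_update_of_half hhalf,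
          prod_update_of_half hhalf']
        rw [← sum_sub_distrib, ← sum_add_distrib]
        refine sum_congr rfl fun f _ => ?_
        split_ifs <;> ring
      have := single_le_sum (f := fun f => if v ∈ f then ∏ u ∈ f, p u else 0)
        (fun f _ => by
          split_ifs
          · exact h.prod_nonneg f
          · exact le_rfl) he
      simp only [if_pos hve, prod_eq_single_of_mem v hve hred, hhalf] at this
      linarith
    have hD2 := conflictWeight_update_zero_le E (MeetAtLast ρ) h hhalf
    have hhalfpow : (16 : ℝ) ^ (-(1 / 4) : ℝ) = 1 / 2 := by
      rw [show (16 : ℝ) = 2 ^ (4 : ℝ) by norm_num, ← Real.rpow_mul (by norm_num)]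
      norm_num [Real.rpow_neg_one]
    calc _ ≤ (2 * conflictWeight E (MeetAtLast ρ) p) *
          (16 : ℝ) ^ (totalWeight E p + -(1 / 4)) := by
          refine mul_le_mul hD2 ?_ (by positivity) (by positivity)
          exact Real.rpow_le_rpow_of_exponent_le (by norm_num) (by linarith)
      _ = conflictWeight E (MeetAtLast ρ) p * (16 : ℝ) ^ totalWeight E p := by
          rw [Real.rpow_add (by norm_num), hhalfpow]
          ring
      _ < 1 / 8 := hpot

theorem exists_next_coloring {E : Finset (Finset V)} {ρ : V → ℕ} (hρ : Function.Injective ρ)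
    {i : ℕ} {p : V → ℝ} (h : IsPartialColoring ρ i p) (hE : NoMono E p)
    (hpot : conflictWeight E (MeetAtLast ρ) p * (16 : ℝ) ^ totalWeight E p < 1 / 8)
    {v : V} (hv : ρ v = i) :
    ∃ q, IsPartialColoring ρ (i + 1) q ∧ NoMono E q ∧
      conflictWeight E (MeetAtLast ρ) q * (16 : ℝ) ^ totalWeight E q < 1 / 8 := by
  by_cases hred : ∃ e ∈ E, ∀ u ∈ e, Function.update p v 1 u = 1
  · exact forced_step hρ h hE hpot hv hred
  by_cases hblue : ∃ e ∈ E, ∀ u ∈ e, Function.update (1 - p) v 1 u = 1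
  · exact forced_step hρ h.one_sub hE.one_sub
      (by rwa [conflictWeight_one_sub, totalWeight_one_sub]) hv hblue
  push Not at hred hblue
  have hhalf : p v = 1 / 2 := (h v).2 hv.ge
  have hs0 := h.update hρ hv (a := 0) (Or.inl rfl)
  have hs1 := h.update hρ hv (a := 1) (Or.inr rfl)
  have hm0 : NoMono E (Function.update p v 0) := by
    refine fun f hf => ⟨exists_red_update_zero hE v f hf, ?_⟩
    obtain ⟨u, hu, hu'⟩ := hblue f hf
    refine ⟨u, hu, fun h0 => hu' ?_⟩
    rw [← sub_zero (1 : ℝ), ← one_sub_update, Pi.sub_apply, h0]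
    simp
  have hm1 : NoMono E (Function.update p v 1) := by
    refine fun f hf => ⟨hred f hf, ?_⟩
    obtain ⟨u, hu, hu'⟩ := exists_red_update_zero hE.one_sub v f hf
    refine ⟨u, hu, fun h0 => hu' ?_⟩
    rw [← sub_self (1 : ℝ), ← one_sub_update, Pi.sub_apply, h0]
    simp
  have hW := totalWeight_update_add E hhalf
  have hD := conflictWeight_update_add_le E (MeetAtLast ρ) h hhalf
  have hD0 := hs0.conflictWeight_nonneg E (MeetAtLast ρ)
  have hD1 := hs1.conflictWeight_nonneg E (MeetAtLast ρ)
  have hDn := h.conflictWeight_nonneg E (MeetAtLast ρ)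
  by_contra! hcon
  have hc0 := hcon _ hs0 hm0
  have hc1 := hcon _ hs1 hm1
  set D0 := conflictWeight E (MeetAtLast ρ) (Function.update p v 0)
  set D1 := conflictWeight E (MeetAtLast ρ) (Function.update p v 1)
  set D := conflictWeight E (MeetAtLast ρ) p
  have hpow : (16 : ℝ) ^ totalWeight E (Function.update p v 0) *
      16 ^ totalWeight E (Function.update p v 1) =
      16 ^ totalWeight E p * 16 ^ totalWeight E p := by
    rw [← Real.rpow_add (by norm_num), ← Real.rpow_add (by norm_num), hW, two_mul]
  have hmul := mul_le_mul hc0 hc1 (by norm_num) (by positivity)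
  have hlt := mul_lt_mul'' hpot hpot (by positivity) (by positivity)
  have hDD : D0 * D1 ≤ D * D := by nlinarith [sq_nonneg (D0 - D1)]
  have := mul_le_mul_of_nonneg_right hDD
    (show (0 : ℝ) ≤ 16 ^ totalWeight E p * 16 ^ totalWeight E p by positivity)
  rw [← hpow] at this
  nlinarith

/-- A hypergraph is two colorable as soon as, for some vertex order, the pairs of edges meeting
in the last vertex of the first one have small total weight. -/
theorem twoColorable_of_conflictWeight_lt {n : ℕ} (ρ : V ≃ Fin n) {E : Finset (Finset V)}
    (hE : ∀ e ∈ E, e.Nonempty)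
    (hpot : conflictWeight E (MeetAtLast fun v => (ρ v : ℕ)) (fun _ => 1 / 2) *
      (16 : ℝ) ^ totalWeight E (fun _ => 1 / 2) < 1 / 8) : TwoColorable E := by
  have hρ : Function.Injective fun v => (ρ v : ℕ) := fun u v huv =>
    ρ.injective (Fin.ext huv)
  have key : ∀ i ≤ n, ∃ q, IsPartialColoring (fun v => (ρ v : ℕ)) i q ∧ NoMono E q ∧
      conflictWeight E (MeetAtLast fun v => (ρ v : ℕ)) q * (16 : ℝ) ^ totalWeight E q
        < 1 / 8 := by
    intro i
    induction i with
    | zero =>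
      refine fun _ => ⟨_, fun v => ⟨fun hv => absurd hv (Nat.not_lt_zero _), fun _ => rfl⟩, ?_,
        hpot⟩
      intro e he
      obtain ⟨v, hv⟩ := hE e he
      exact ⟨⟨v, hv, by norm_num⟩, v, hv, by norm_num⟩
    | succ i ih =>
      intro hi
      obtain ⟨q, hq, hm, hp⟩ := ih (by omega)
      exact exists_next_coloring hρ hq hm hp (v := ρ.symm ⟨i, hi⟩) (by simp)
  obtain ⟨q, hq, hm, -⟩ := key n le_rfl
  refine ⟨fun v => decide (q v = 0), fun f hf => ?_⟩
  obtain ⟨⟨u, hu, hu'⟩, w, hw, hw'⟩ := hm f hf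
  have hu0 : q u = 0 := ((hq u).1 (ρ u).2).resolve_right hu'
  exact ⟨⟨u, hu, by simp [hu0]⟩, w, hw, by simp [hw']⟩

end Potential

section RandomOrder

variable {V : Type} [Fintype V] [DecidableEq V]

/-- Each vertex of `e` is the last one of `e` in a proportion `1 / |e|` of all orders. -/
theorem card_mul_card_last {n : ℕ} {e : Finset V} {v : V} (hv : v ∈ e) :
    e.card * (univ.filter fun ρ : V ≃ Fin n => ∀ u ∈ e, ρ u ≤ ρ v).card =
      Fintype.card (V ≃ Fin n) := by
  have hswap : ∀ w ∈ e, (univ.filter fun ρ : V ≃ Fin n => ∀ u ∈ e, ρ u ≤ ρ w).card =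
      (univ.filter fun ρ : V ≃ Fin n => ∀ u ∈ e, ρ u ≤ ρ v).card := by
    intro w hw
    have hmem : ∀ u ∈ e, Equiv.swap v w u ∈ e := fun u hu => by
      rw [Equiv.swap_apply_def]
      split_ifs <;> assumption
    refine card_bij' (fun ρ _ => (Equiv.swap v w).trans ρ) (fun ρ _ => (Equiv.swap v w).trans ρ)
      ?_ ?_ ?_ ?_
    · intro ρ hρ
      simp only [mem_filter, mem_univ, true_and] at hρ ⊢
      intro u hu
      simpa using hρ _ (hmem u hu)
    · intro ρ hρ
      simp only [mem_filter, mem_univ, true_and] at hρ ⊢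
      intro u hu
      simpa using hρ _ (hmem u hu)
    · intro ρ _
      ext; simp
    · intro ρ _
      ext; simp
  have hunion : (univ : Finset (V ≃ Fin n)) =
      e.biUnion fun w => univ.filter fun ρ : V ≃ Fin n => ∀ u ∈ e, ρ u ≤ ρ w := by
    ext ρ
    simp only [mem_univ, mem_biUnion, mem_filter, true_and, true_iff]
    exact exists_max_image e ρ ⟨v, hv⟩
  have hcard : (univ : Finset (V ≃ Fin n)).card =
      ∑ w ∈ e, (univ.filter fun ρ : V ≃ Fin n => ∀ u ∈ e, ρ u ≤ ρ w).card := by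
    conv_lhs => rw [hunion]
    refine card_biUnion ?_
    intro w hw w' hw' hne
    rw [Function.onFun, disjoint_left]
    intro ρ hρ hρ'
    simp only [mem_filter, mem_univ, true_and] at hρ hρ'
    exact hne (ρ.injective (le_antisymm (hρ' w hw) (hρ w' hw')))
  rw [← card_univ, hcard, sum_congr rfl hswap, sum_const, smul_eq_mul]

open Classical in
theorem card_mul_card_meetAtLast_le {n : ℕ} (e f : Finset V) :
    e.card * (univ.filter fun ρ : V ≃ Fin n => MeetAtLast (fun v => (ρ v : ℕ)) e f).card ≤
      Fintype.card (V ≃ Fin n) := by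
  by_cases h : ∃ v, ∀ u, u ∈ e ∧ u ∈ f ↔ u = v
  · obtain ⟨v, hv⟩ := h
    rw [← card_mul_card_last (n := n) ((hv v).2 rfl).1]
    refine Nat.mul_le_mul_left _ (card_le_card fun ρ => ?_)
    simp only [mem_filter, mem_univ, true_and]
    rintro ⟨w, hw, hlast⟩ u hu
    obtain rfl : w = v := (hv w).1 ((hw w).2 rfl)
    exact hlast u hu
  · rw [filter_eq_empty_iff.2 fun ρ _ hm => h (hm.imp fun w hw => hw.1), card_empty, mul_zero]
    exact Nat.zero_le _

theorem exists_order_conflictWeight_le {E : Finset (Finset V)} {k : ℕ} (hk : 0 < k)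
    (hE : ∀ e ∈ E, k ≤ e.card) :
    ∃ ρ : V ≃ Fin (Fintype.card V),
      conflictWeight E (MeetAtLast fun v => (ρ v : ℕ)) (fun _ => 1 / 2) ≤
        qH E ^ 2 / (2 * k) := by
  classical
  set N := Fintype.card (V ≃ Fin (Fintype.card V))
  have hne : (univ : Finset (V ≃ Fin (Fintype.card V))).Nonempty :=
    ⟨Fintype.equivFin V, mem_univ _⟩
  have hk' : (0 : ℝ) < k := by exact_mod_cast hk
  suffices h : ∑ ρ : V ≃ Fin (Fintype.card V),
      conflictWeight E (MeetAtLast fun v => (ρ v : ℕ)) (fun _ => 1 / 2) ≤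
        ∑ _ρ : V ≃ Fin (Fintype.card V), qH E ^ 2 / (2 * k) by
    obtain ⟨ρ, -, hρ⟩ := exists_le_of_sum_le hne h
    exact ⟨ρ, hρ⟩
  simp only [conflictWeight_half]
  rw [sum_comm]
  have hrhs : ∑ _ρ : V ≃ Fin (Fintype.card V), qH E ^ 2 / (2 * k) =
      ∑ e ∈ E, ∑ f ∈ E,
        (2 : ℝ) ^ (1 - (e.card : ℤ)) * (2 : ℝ) ^ (1 - (f.card : ℤ)) / 2 * (N / k) := by
    rw [sum_const, card_univ, nsmul_eq_mul, qH, sq, sum_mul_sum, sum_div, mul_sum]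
    refine sum_congr rfl fun e _ => ?_
    rw [sum_div, mul_sum]
    refine sum_congr rfl fun f _ => ?_
    field_simp
    ring
  rw [hrhs]
  refine sum_le_sum fun e he => ?_
  rw [sum_comm]
  refine sum_le_sum fun f _ => ?_
  rw [← mul_sum]
  refine mul_le_mul_of_nonneg_left ?_ (by positivity)
  rw [sum_boole, le_div_iff₀ hk', mul_comm]
  exact_mod_cast (Nat.mul_le_mul_right _ (hE e he)).trans (card_mul_card_meetAtLast_le e f)

end RandomOrder

theorem sq_div_mul_rpow_lt {k : ℕ} (hk : 0 < k) {q : ℝ} (hq0 : 0 ≤ q)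
    (hq : q ≤ 1 / 10 * Real.log k) : q ^ 2 / (2 * k) * (16 : ℝ) ^ q < 1 / 8 := by
  have hk1 : (1 : ℝ) ≤ k := by exact_mod_cast hk
  have hk0 : (0 : ℝ) < k := by linarith
  have hlog : Real.log k ≤ 4 * (k : ℝ) ^ (1 / 4 : ℝ) := by
    have := Real.log_le_rpow_div hk0.le (show (0 : ℝ) < 1 / 4 by norm_num)
    linarith
  have hlog16 : Real.log 16 ≤ 5 := by
    rw [show (16 : ℝ) = 2 ^ 4 by norm_num, Real.log_pow]
    push_cast
    linarith [Real.log_two_lt_d9]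
  have hpow : (16 : ℝ) ^ q ≤ (k : ℝ) ^ (1 / 2 : ℝ) := by
    rw [Real.rpow_def_of_pos (by norm_num), Real.rpow_def_of_pos hk0]
    refine Real.exp_le_exp.2 ?_
    nlinarith
  have hsq : q ^ 2 ≤ 4 / 25 * (k : ℝ) ^ (1 / 2 : ℝ) := by
    have h1 : (k : ℝ) ^ (1 / 2 : ℝ) = ((k : ℝ) ^ (1 / 4 : ℝ)) ^ 2 := by
      rw [← Real.rpow_natCast, ← Real.rpow_mul hk0.le]
      norm_num
    have h2 : q ≤ 2 / 5 * (k : ℝ) ^ (1 / 4 : ℝ) := by linarith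
    rw [h1]
    nlinarith
  have hkk : (k : ℝ) ^ (1 / 2 : ℝ) * (k : ℝ) ^ (1 / 2 : ℝ) = k := by
    rw [← Real.rpow_add hk0]
    norm_num
  have hmul : q ^ 2 * (16 : ℝ) ^ q ≤ 4 / 25 * k := by
    calc _ ≤ (4 / 25 * (k : ℝ) ^ (1 / 2 : ℝ)) * (k : ℝ) ^ (1 / 2 : ℝ) :=
          mul_le_mul hsq hpow (by positivity) (by positivity)
      _ = 4 / 25 * k := by rw [mul_assoc, hkk]
  rw [div_mul_eq_mul_div, div_lt_iff₀ (by positivity)]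
  linarith

/-- There is a constant `δ > 0` such that for all sufficiently large `k`, every hypergraph `H`
with `s_min(H) ≥ k` and `q(H) ≤ δ·log k` is two colorable. -/
theorem two_colorable_of_q_le_log :
    ∃ δ : ℝ, 0 < δ ∧ ∃ k0 : ℕ, ∀ k : ℕ, k0 ≤ k →
      ∀ (V : Type) [Fintype V] (E : Finset (Finset V)),
        (∀ f ∈ E, 2 ≤ f.card) → (∀ f ∈ E, k ≤ f.card) →
        qH E ≤ δ * Real.log k → TwoColorable E := by
  refine ⟨1 / 10, by norm_num, 1, fun k hk V _ E hE2 hEk hq => ?_⟩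
  classical
  obtain ⟨ρ, hρ⟩ := exists_order_conflictWeight_le hk hEk
  refine twoColorable_of_conflictWeight_lt ρ (fun e he => card_pos.1 (by linarith [hE2 e he])) ?_
  rw [totalWeight_half]
  have hq0 : 0 ≤ qH E := sum_nonneg fun e _ => by positivity
  exact (mul_le_mul_of_nonneg_right hρ (by positivity)).trans_lt (sq_div_mul_rpow_lt hk hq0 hq)
end

section
/- There exist constants δ > 0 and α_A, α_B, α_C, α_D > 0 such that for all sufficiently large k the following holds: for every hypergraph H=(V,E) with s_min(H) ≥ k and 1 ≤ q(H) ≤ δ·log k, and for every edge e ∈ E, in the random two-phase coloring the probability that all vertices of e receive final color red and none of the bad events A, B, C, D occurs is at most 1/(3·q(H)·2^{|e|−1}). -/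
open MeasureTheory Finset
open scoped Classical

/-- The uniform probability measure on `{blue, red}` (blue = `true`, red = `false`). -/
noncomputable def muBool : Measure Bool := (PMF.uniformOfFintype Bool).toMeasure

/-- The uniform probability measure on the interval `(0,1)`. -/
noncomputable def muW : Measure ℝ := volume.restrict (Set.Ioo (0 : ℝ) 1)

/-- The random two-phase coloring model: each vertex independently receives a uniform
initial color (first component) and a uniform weight in `(0,1)` (second component). -/
noncomputable def muH (V : Type) [Fintype V] : Measure ((V → Bool) × (V → ℝ)) :=
  (Measure.pi fun _ : V => muBool).prod (Measure.pi fun _ : V => muW)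

/-- `f` is (initially) monochromatic under `ic`. -/
def Mono {V : Type} (ic : V → Bool) (f : Finset V) : Prop :=
  ∀ u ∈ f, ∀ v ∈ f, ic u = ic v

/-- Edge `f` is a reason to recolor `v` (given partial final coloring `c`): `v ∈ f ∈ E`,
`f` is initially monochromatic, `v` is the maximum-weight vertex of `f`, and every other
vertex of `f` keeps its initial color. -/
def Reason {V : Type} (E : Finset (Finset V)) (ic : V → Bool) (w : V → ℝ)
    (c : V → Bool) (v : V) : Prop :=
  ∃ f ∈ E, v ∈ f ∧ Mono ic f ∧ (∀ u ∈ f, w u ≤ w v) ∧ ∀ u ∈ f, u ≠ v → c u = ic u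

/-- `c` is the final coloring produced by the recoloring procedure (processing vertices in
order of increasing weight): `c v` differs from `ic v` iff there is a reason to recolor `v`.
For an injective weight function this recurrence determines `c` uniquely. -/
def IsFinalColoring {V : Type} (E : Finset (Finset V)) (ic : V → Bool) (w : V → ℝ)
    (c : V → Bool) : Prop :=
  ∀ v, (Reason E ic w c v → c v = !(ic v)) ∧ (¬ Reason E ic w c v → c v = ic v)

/-- Bad event `A`: more than `αA·q` edges are initially monochromatic. -/
def BadA {V : Type} (E : Finset (Finset V)) (aA q : ℝ) (ic : V → Bool) : Prop :=
  aA * q < ((E.filter fun f => Mono ic f).card : ℝ)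

/-- Bad event `B`: some edge `f` is light, i.e. initially monochromatic with all weights
below `1 − p_{|f|}` where `p_j = ln(αB·q)/j`. -/
def BadB {V : Type} (E : Finset (Finset V)) (aB q : ℝ) (ic : V → Bool) (w : V → ℝ) : Prop :=
  ∃ f ∈ E, Mono ic f ∧ ∀ v ∈ f, w v < 1 - Real.log (aB * q) / (f.card : ℝ)

/-- `f` is almost monochromatic under `ic`. -/
def AlmostMono {V : Type} (ic : V → Bool) (f : Finset V) : Prop :=
  ∃ v ∈ f, ∀ u ∈ f, u ≠ v → ∀ u' ∈ f, u' ≠ v → ic u = ic u'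

/-- Bad event `C`: `∑_j Q_j/j > αC·q`, where `Q_j` is the number of almost monochromatic
edges of size `j` (the sum below is over the almost monochromatic edges, weighted `1/|f|`). -/
def BadC {V : Type} (E : Finset (Finset V)) (aC q : ℝ) (ic : V → Bool) : Prop :=
  aC * q < ∑ f ∈ E.filter fun f => AlmostMono ic f, (1 : ℝ) / (f.card : ℝ)

/-- The second-largest weight among the vertices of `f`. -/
noncomputable def secondWeight {V : Type} [DecidableEq V] (f : Finset V) (w : V → ℝ) : ℝ :=
  sSup ((f.offDiag.image fun p => min (w p.1) (w p.2) : Finset ℝ) : Set ℝ)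

/-- The second weight deficit `d₂(f) := (|f|+1)(1 − w₂(f))` for initially monochromatic `f`,
and `0` otherwise. -/
noncomputable def d2 {V : Type} [DecidableEq V] (f : Finset V) (ic : V → Bool)
    (w : V → ℝ) : ℝ :=
  if Mono ic f then ((f.card : ℝ) + 1) * (1 - secondWeight f w) else 0

/-- Bad event `D`: `∑_{f ∈ E} d₂(f) > αD·q`. -/
def BadD {V : Type} [DecidableEq V] (E : Finset (Finset V)) (aD q : ℝ) (ic : V → Bool)
    (w : V → ℝ) : Prop :=
  aD * q < ∑ f ∈ E, d2 f ic w

/-- The edges meeting `e` exactly in `v` whose vertices outside `e` are all initially blue. -/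
noncomputable def threats {V : Type} [DecidableEq V] (E : Finset (Finset V)) (e : Finset V)
    (ic : V → Bool) (v : V) : Finset (Finset V) :=
  E.filter fun f => f ∩ e = {v} ∧ ∀ u ∈ f \ e, ic u = true

/-- The total weight `∑ 1 / (|f| + 1)` of the edges threatening `v`. -/
noncomputable def threatLoad {V : Type} [DecidableEq V] (E : Finset (Finset V)) (e : Finset V)
    (ic : V → Bool) (v : V) : ℝ :=
  ∑ f ∈ threats E e ic v, 1 / ((f.card : ℝ) + 1)

section Deterministic

variable {V : Type} [DecidableEq V] {E : Finset (Finset V)} {e f : Finset V} {ic c : V → Bool}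
  {w : V → ℝ} {v : V}

lemma threatLoad_nonneg (v : V) : 0 ≤ threatLoad E e ic v :=
  Finset.sum_nonneg fun _ _ => by positivity

lemma threatLoad_congr {ic' : V → Bool} (h : ∀ u ∉ e, ic u = ic' u) (v : V) :
    threatLoad E e ic v = threatLoad E e ic' v := by
  have : threats E e ic v = threats E e ic' v := by
    refine Finset.filter_congr fun f _ => ?_
    refine and_congr_right fun _ => forall₂_congr fun u hu => ?_
    rw [h u (Finset.mem_sdiff.1 hu).2]
  rw [threatLoad, threatLoad, this]

lemma secondWeight_le {a : ℝ} (hf : 2 ≤ f.card)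
    (h : ∀ u ∈ f, w u ≤ a) : secondWeight f w ≤ a := by
  have hne : f.offDiag.Nonempty := by
    rw [← Finset.card_pos, Finset.offDiag_card]
    have : f.card * 2 ≤ f.card * f.card := Nat.mul_le_mul_left _ hf
    omega
  refine csSup_le (Finset.coe_nonempty.2 (hne.image _)) fun x hx => ?_
  obtain ⟨p, hp, rfl⟩ := Finset.mem_image.1 (Finset.mem_coe.1 hx)
  exact (min_le_left _ _).trans (h _ (Finset.mem_offDiag.1 hp).1)

lemma le_d2 {a : ℝ} (hm : Mono ic f) (hf : 2 ≤ f.card) (h : ∀ u ∈ f, w u ≤ a) :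
    ((f.card : ℝ) + 1) * (1 - a) ≤ d2 f ic w := by
  rw [d2, if_pos hm]
  have := secondWeight_le hf h
  gcongr

lemma d2_nonneg (hf : 2 ≤ f.card) (h : ∀ u, w u < 1) : 0 ≤ d2 f ic w := by
  by_cases hm : Mono ic f
  · simpa using le_d2 hm hf fun u _ => (h u).le
  · rw [d2, if_neg hm]

omit [DecidableEq V] in
lemma exists_blue_of_final_red (hc : IsFinalColoring E ic w c) (he : e ∈ E) (hne : e.Nonempty)
    (hred : ∀ v ∈ e, c v = false) : ∃ v ∈ e, ic v = true := by
  by_contra! h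
  have h' : ∀ v ∈ e, ic v = false := fun v hv => by simpa using h v hv
  obtain ⟨v, hv, hmax⟩ := e.exists_max_image w hne
  have := (hc v).1 ⟨e, he, hv, fun a ha b hb => by rw [h' a ha, h' b hb], hmax,
    fun u hu _ => by rw [h' u hu, hred u hu]⟩
  rw [h' v hv, hred v hv] at this
  simp at this

lemma exists_threat (hc : IsFinalColoring E ic w c) (hred : ∀ v ∈ e, c v = false)
    (hv : v ∈ e) (hb : ic v = true) :
    ∃ f ∈ threats E e ic v, Mono ic f ∧ ∀ u ∈ f, w u ≤ w v := by
  have hr : Reason E ic w c v := by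
    by_contra h
    have := (hc v).2 h
    rw [hb, hred v hv] at this
    simp at this
  obtain ⟨f, hf, hvf, hm, hmax, hk⟩ := hr
  refine ⟨f, Finset.mem_filter.2 ⟨hf, ?_, fun u hu => ?_⟩, hm, hmax⟩
  · ext u
    simp only [Finset.mem_inter, Finset.mem_singleton]
    refine ⟨fun ⟨huf, hue⟩ => ?_, fun h => h ▸ ⟨hvf, hv⟩⟩
    by_contra hne
    have := hk u huf hne
    rw [hred u hue, hm u huf v hvf, hb] at this
    simp at this
  · rw [hm u (Finset.mem_sdiff.1 hu).1 v hvf, hb]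

lemma one_le_exp_mul_prod {B : ℝ} (hE : ∀ f ∈ E, 2 ≤ f.card) (hw : ∀ u, w u < 1)
    (hc : IsFinalColoring E ic w c) (hred : ∀ v ∈ e, c v = false)
    (hD : ∑ f ∈ E, d2 f ic w ≤ B) :
    1 ≤ Real.exp B * ∏ v ∈ e, if ic v = true then
      ∑ f ∈ threats E e ic v, Real.exp (-(((f.card : ℝ) + 1) * (1 - w v))) else 1 := by
  have H : ∀ v, ∃ f, v ∈ e → ic v = true →
      f ∈ threats E e ic v ∧ Mono ic f ∧ ∀ u ∈ f, w u ≤ w v := fun v => by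
    by_cases h : v ∈ e ∧ ic v = true
    · obtain ⟨f, h1, h2⟩ := exists_threat hc hred h.1 h.2
      exact ⟨f, fun _ _ => ⟨h1, h2⟩⟩
    · exact ⟨∅, fun h1 h2 => absurd ⟨h1, h2⟩ h⟩
  choose F hF using H
  rw [← Finset.prod_filter]
  set S := e.filter fun v => ic v = true with hS
  have hFS : ∀ v ∈ S, F v ∈ threats E e ic v ∧ Mono ic (F v) ∧ ∀ u ∈ F v, w u ≤ w v :=
    fun v hv => hF v (Finset.mem_filter.1 hv).1 (Finset.mem_filter.1 hv).2
  have hFE : ∀ v ∈ S, F v ∈ E ∧ F v ∩ e = {v} := fun v hv =>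
    ⟨(Finset.mem_filter.1 (hFS v hv).1).1, (Finset.mem_filter.1 (hFS v hv).1).2.1⟩
  have hinj : Set.InjOn F S := fun u hu v hv huv => by
    have := (hFE u hu).2
    rw [huv, (hFE v hv).2] at this
    exact (Finset.singleton_injective this).symm
  have hsum : ∑ v ∈ S, (((F v).card : ℝ) + 1) * (1 - w v) ≤ B := by
    calc _ ≤ ∑ v ∈ S, d2 (F v) ic w :=
          Finset.sum_le_sum fun v hv => le_d2 (hFS v hv).2.1 (hE _ (hFE v hv).1) (hFS v hv).2.2
      _ = ∑ f ∈ S.image F, d2 f ic w := 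
          (Finset.sum_image (f := fun f => d2 f ic w) hinj).symm
      _ ≤ ∑ f ∈ E, d2 f ic w := by
          refine Finset.sum_le_sum_of_subset_of_nonneg ?_ fun f hf _ => d2_nonneg (hE f hf) hw
          exact Finset.image_subset_iff.2 fun v hv => (hFE v hv).1
      _ ≤ B := hD
  calc (1 : ℝ) = Real.exp B * Real.exp (-B) := by rw [← Real.exp_add]; simp
    _ ≤ Real.exp B * Real.exp (∑ v ∈ S, -((((F v).card : ℝ) + 1) * (1 - w v))) := by
        rw [Finset.sum_neg_distrib]; gcongr
    _ ≤ _ := by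
        rw [Real.exp_sum]
        gcongr with v hv
        exact Finset.single_le_sum
          (f := fun f : Finset V => Real.exp (-(((f.card : ℝ) + 1) * (1 - w v))))
          (fun _ _ => (Real.exp_pos _).le) (hFS v hv).1

lemma sum_threatLoad_le {B : ℝ} (hE : ∀ f ∈ E, 2 ≤ f.card)
    (hC : ∑ f ∈ E.filter fun f => AlmostMono ic f, (1 : ℝ) / (f.card : ℝ) ≤ B) :
    ∑ v ∈ e, threatLoad E e ic v ≤ B := by
  refine le_trans ?_ hC
  have hdisj : (e : Set V).PairwiseDisjoint (threats E e ic) := fun u _ v _ huv => by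
    refine Finset.disjoint_left.2 fun f hu hv => huv ?_
    have h1 := (Finset.mem_filter.1 hu).2.1
    rw [(Finset.mem_filter.1 hv).2.1] at h1
    exact (Finset.singleton_injective h1).symm
  unfold threatLoad
  rw [← Finset.sum_biUnion hdisj]
  refine (Finset.sum_le_sum fun f hf => ?_).trans
    (Finset.sum_le_sum_of_subset_of_nonneg (f := fun f : Finset V => (1 : ℝ) / (f.card : ℝ))
      ?_ fun _ _ _ => by positivity)
  · obtain ⟨v, _, hf⟩ := Finset.mem_biUnion.1 hf
    have : (0 : ℝ) < f.card := by
      have := hE f (Finset.mem_filter.1 hf).1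
      positivity
    gcongr
    linarith
  · intro f hf
    obtain ⟨v, _, hf⟩ := Finset.mem_biUnion.1 hf
    obtain ⟨hfE, hfv, hblue⟩ := Finset.mem_filter.1 hf
    refine Finset.mem_filter.2 ⟨hfE, v, ?_, ?_⟩
    · exact (Finset.mem_inter.1 (hfv ▸ Finset.mem_singleton_self v)).1
    · have key : ∀ u ∈ f, u ≠ v → ic u = true := fun u hu hne =>
        hblue u (Finset.mem_sdiff.2 ⟨hu, fun hue => hne <| by
          have : u ∈ f ∩ e := Finset.mem_inter.2 ⟨hu, hue⟩
          rwa [hfv, Finset.mem_singleton] at this⟩)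
      intro u hu hne u' hu' hne'
      rw [key u hu hne, key u' hu' hne']

end Deterministic

section Counting

lemma sum_prod_ite_le {ι : Type*} [Fintype ι] [DecidableEq ι] (y : ι → ℝ) (hy : ∀ i, 0 ≤ y i) :
    ∑ σ : ι → Bool, (if ∃ i, σ i = true then ∏ i, (if σ i = true then y i else 1) else 0) ≤
      (∑ i, y i) * Real.exp (∑ i, y i) := by
  have htot : ∑ σ : ι → Bool, ∏ i, (if σ i = true then y i else 1) = ∏ i, (1 + y i) := by
    have := Finset.prod_univ_sum (fun _ : ι => (Finset.univ : Finset Bool))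
      fun i b => if b = true then y i else 1
    rw [Fintype.piFinset_univ] at this
    rw [← this]
    simp [add_comm]
  have hsplit : ∑ σ : ι → Bool, (if ∃ i, σ i = true then
      ∏ i, (if σ i = true then y i else 1) else 0) = ∏ i, (1 + y i) - 1 := by
    rw [← htot, ← Finset.add_sum_erase _ _ (Finset.mem_univ fun _ => false),
      ← Finset.add_sum_erase _ (fun σ : ι → Bool => ∏ i, (if σ i = true then y i else 1))
        (Finset.mem_univ fun _ => false)]
    simp only [Bool.false_eq_true, exists_false, if_false, Finset.prod_const_one, zero_add,
      add_sub_cancel_left]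
    refine Finset.sum_congr rfl fun σ hσ => if_pos ?_
    by_contra! h
    exact (Finset.mem_erase.1 hσ).1 (funext fun i => by simpa using h i)
  rw [hsplit]
  have h1 := Real.prod_one_add_le_exp_sum Finset.univ hy
  set s := ∑ i, y i
  have h2 := Real.add_one_le_exp (-s)
  have h3 : Real.exp s * Real.exp (-s) = 1 := by rw [← Real.exp_add]; simp
  nlinarith [Real.exp_pos s]

lemma card_filter_forall_eq_true {V : Type*} [Fintype V] [DecidableEq V] (A : Finset V) :
    (Finset.univ.filter fun ic : V → Bool => ∀ u ∈ A, ic u = true).card =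
      2 ^ (Fintype.card V - A.card) := by
  have : (Finset.univ.filter fun ic : V → Bool => ∀ u ∈ A, ic u = true) =
      Fintype.piFinset fun u => if u ∈ A then {true} else Finset.univ := by
    ext ic
    simp only [Finset.mem_filter, Finset.mem_univ, true_and, Fintype.mem_piFinset]
    refine forall_congr' fun u => ?_
    split_ifs with h <;> simp [h]
  rw [this, Fintype.card_piFinset, ← Finset.card_compl]
  simp only [apply_ite Finset.card, Finset.card_singleton, Finset.card_univ, Fintype.card_bool]
  rw [Finset.prod_ite]
  simp only [Finset.prod_const_one, one_mul, Finset.prod_const]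
  congr 2
  ext; simp

variable {V : Type} [Fintype V] [DecidableEq V]

lemma sum_colorings_le (e : Finset V) (Y : (V → Bool) → V → ℝ) (hY : ∀ ic v, 0 ≤ Y ic v)
    (hloc : ∀ ic ic', (∀ u ∉ e, ic u = ic' u) → ∀ v, Y ic v = Y ic' v) (B : ℝ) :
    2 ^ e.card * ∑ ic : V → Bool, (if (∃ v ∈ e, ic v = true) ∧ ∑ v ∈ e, Y ic v ≤ B then
      ∏ v ∈ e, (if ic v = true then Y ic v else 1) else 0) ≤
      Real.exp B * ∑ ic : V → Bool, ∑ v ∈ e, Y ic v := by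
  let φ := (Equiv.piEquivPiSubtypeProd (fun v => v ∈ e) fun _ : V => Bool).symm
  have hφe : ∀ p (v : {v // v ∈ e}), φ p v = p.1 v := fun p v => by
    simp [φ, Equiv.piEquivPiSubtypeProd]
  let Z : ({v // v ∉ e} → Bool) → V → ℝ := fun τ => Y (φ (fun _ => false, τ))
  have hYZ : ∀ p, Y (φ p) = Z p.2 := fun p => funext fun v => hloc _ _ (fun u hu => by
    simp [φ, Equiv.piEquivPiSubtypeProd, hu]) v
  rw [← φ.sum_comp, ← φ.sum_comp, Fintype.sum_prod_type_right, Fintype.sum_prod_type_right,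
    Finset.mul_sum, Finset.mul_sum]
  refine Finset.sum_le_sum fun τ _ => ?_
  simp only [hYZ, Finset.sum_const, Finset.card_univ, Fintype.card_pi, Fintype.card_bool,
    Finset.prod_const, nsmul_eq_mul]
  rw [Fintype.card_coe]
  push_cast
  rw [mul_left_comm]
  gcongr
  have hsum : ∑ v ∈ e, Z τ v = ∑ v : {v // v ∈ e}, Z τ v := (Finset.sum_coe_sort e (Z τ)).symm
  have h0 : 0 ≤ ∑ v ∈ e, Z τ v := Finset.sum_nonneg fun v _ => hY _ v
  by_cases hB : ∑ v ∈ e, Z τ v ≤ B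
  · simp only [hB, and_true]
    have := sum_prod_ite_le (fun v : {v // v ∈ e} => Z τ v) fun v => hY _ _
    calc _ = ∑ σ : {v // v ∈ e} → Bool, (if ∃ i, σ i = true then
          ∏ i, (if σ i = true then Z τ i else 1) else 0) := by
          refine Finset.sum_congr rfl fun σ _ => ?_
          have hex : (∃ v ∈ e, φ (σ, τ) v = true) ↔ ∃ i, σ i = true := by
            rw [Subtype.exists]
            refine exists_congr fun v => ⟨fun ⟨h, hv⟩ => ⟨h, ?_⟩, fun ⟨h, hv⟩ => ⟨h, ?_⟩⟩
            · exact (hφe (σ, τ) ⟨v, h⟩).symm.trans hv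
            · exact (hφe (σ, τ) ⟨v, h⟩).trans hv
          rw [← Finset.prod_coe_sort]
          simp only [hex, hφe]
      _ ≤ _ := this
      _ ≤ _ := by
        rw [← hsum, mul_comm]
        gcongr
  · simp only [hB, and_false, if_false, Finset.sum_const_zero]
    positivity

lemma sum_threatLoad_colorings_le {k : ℕ} (hk : 0 < k) (E : Finset (Finset V))
    (hE : ∀ f ∈ E, k ≤ f.card) (e : Finset V) :
    ∑ ic : V → Bool, ∑ v ∈ e, threatLoad E e ic v ≤ 2 ^ Fintype.card V * (qH E / k) := by
  have hcount : ∀ v ∈ e, ∑ ic : V → Bool, threatLoad E e ic v =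
      ∑ f ∈ E, if f ∩ e = {v} then
        (2 : ℝ) ^ (Fintype.card V - (f \ e).card) * (1 / ((f.card : ℝ) + 1)) else 0 := by
    intro v _
    simp only [threatLoad, threats, Finset.sum_filter]
    rw [Finset.sum_comm]
    refine Finset.sum_congr rfl fun f _ => ?_
    split_ifs with h
    · simp only [h, true_and]
      rw [← Finset.sum_filter, Finset.sum_const, nsmul_eq_mul]
      congr 1
      exact_mod_cast (by convert card_filter_forall_eq_true (f \ e))
    · simp [h]
  rw [Finset.sum_comm, Finset.sum_congr rfl hcount, Finset.sum_comm, qH, Finset.sum_div,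
    Finset.mul_sum]
  refine Finset.sum_le_sum fun f hf => ?_
  by_cases hv : ∃ v ∈ e, f ∩ e = {v}
  · obtain ⟨v, hve, hv⟩ := hv
    rw [Finset.sum_eq_single v (fun u _ hu => if_neg fun h => hu <|
      Finset.singleton_injective (h.symm.trans hv)) (fun h => absurd hve h), if_pos hv]
    have h1 : (f \ e).card + 1 = f.card := by
      rw [← Finset.card_sdiff_add_card_inter f e, hv, Finset.card_singleton]
    have h2 : (f \ e).card ≤ Fintype.card V := Finset.card_le_univ _
    have h3 : (2 : ℝ) ^ (Fintype.card V - (f \ e).card) =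
        2 ^ Fintype.card V * (2 : ℝ) ^ (1 - (f.card : ℤ)) := by
      rw [← zpow_natCast, ← zpow_natCast, ← zpow_add₀ two_ne_zero]
      congr 1
      push_cast [h2]
      omega
    have h4 : (k : ℝ) ≤ f.card := by exact_mod_cast hE f hf
    have h5 : (0 : ℝ) < k := by exact_mod_cast hk
    rw [h3, mul_assoc, ← div_eq_mul_one_div]
    gcongr
    linarith
  · rw [Finset.sum_eq_zero fun v hve => if_neg fun h => hv ⟨v, hve, h⟩]
    positivity

end Counting

section Integration

instance : IsProbabilityMeasure muW := ⟨by simp [muW]⟩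

instance : IsProbabilityMeasure muBool := by unfold muBool; infer_instance

lemma muBool_singleton (b : Bool) : muBool {b} = 2⁻¹ := by
  rw [muBool, PMF.toMeasure_apply_singleton _ _ (measurableSet_singleton _)]
  simp

lemma pi_muBool_singleton {V : Type} [Fintype V] (ic : V → Bool) :
    (Measure.pi fun _ : V => muBool) {ic} = ENNReal.ofReal (1 / 2 ^ Fintype.card V) := by
  rw [Measure.pi_singleton]
  simp only [muBool_singleton, Finset.prod_const, Finset.card_univ]
  rw [one_div, ENNReal.ofReal_inv_of_pos (by positivity), ENNReal.ofReal_pow (by norm_num)]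
  simp [ENNReal.inv_pow]

lemma ae_injective_and_lt_one (V : Type) [Fintype V] :
    ∀ᵐ w ∂(Measure.pi fun _ : V => muW), Function.Injective w ∧ ∀ v, w v < 1 := by
  classical
  have hr : (Measure.pi fun _ : V => muW) =
      (volume : Measure (V → ℝ)).restrict (Set.univ.pi fun _ => Set.Ioo (0 : ℝ) 1) :=
    (Measure.restrict_pi_pi (fun _ : V => (volume : Measure ℝ)) _).symm
  rw [hr]
  refine Filter.Eventually.and (ae_restrict_of_ae ?_) ?_
  · have h : ∀ p : V × V, p.1 ≠ p.2 → ∀ᵐ w : V → ℝ, w p.1 ≠ w p.2 := by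
      intro p hp
      let s : Submodule ℝ (V → ℝ) := LinearMap.ker
        (LinearMap.proj (R := ℝ) (φ := fun _ : V => ℝ) p.1 - LinearMap.proj p.2)
      have hs : s ≠ ⊤ := fun h => by
        have : (Pi.single p.1 1 : V → ℝ) ∈ s := h ▸ Submodule.mem_top
        simp [s, LinearMap.mem_ker, hp.symm] at this
      have h0 := Measure.addHaar_submodule (volume : Measure (V → ℝ)) s hs
      rw [ae_iff]
      convert h0 using 2
      ext w
      simp [s, LinearMap.mem_ker, sub_eq_zero]
    have h' : ∀ᵐ w : V → ℝ, ∀ p : V × V, p.1 ≠ p.2 → w p.1 ≠ w p.2 :=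
      ae_all_iff.2 fun p => by
        by_cases hp : p.1 = p.2
        · simp [hp]
        · simpa [hp] using h p hp
    filter_upwards [h'] with w hw u v huv
    by_contra hne
    exact hw (u, v) hne huv
  · filter_upwards [ae_restrict_mem (MeasurableSet.univ_pi fun _ => measurableSet_Ioo)]
      with w hw v
    exact (hw v trivial).2

lemma lintegral_exp_muW_le {a : ℝ} (ha : 0 < a) :
    ∫⁻ x, ENNReal.ofReal (Real.exp (-(a * (1 - x)))) ∂muW ≤ ENNReal.ofReal (1 / a) := by
  have hc : Continuous fun x : ℝ => Real.exp (-(a * (1 - x))) := by fun_prop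
  rw [muW, Measure.restrict_congr_set Ioo_ae_eq_Ioc, ← ofReal_integral_eq_lintegral_ofReal
    (hc.integrableOn_Ioc) (Filter.Eventually.of_forall fun _ => (Real.exp_pos _).le),
    ← intervalIntegral.integral_of_le zero_le_one]
  refine ENNReal.ofReal_le_ofReal ?_
  have hd : ∀ x ∈ Set.uIcc (0 : ℝ) 1, HasDerivAt (fun x => Real.exp (-(a * (1 - x))) / a)
      (Real.exp (-(a * (1 - x)))) x := fun x _ => by
    have h1 : HasDerivAt (fun x : ℝ => -(a * (1 - x))) a x := by
      simpa using (((hasDerivAt_id x).const_sub 1).const_mul a).fun_neg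
    have h2 := h1.exp.div_const a
    rwa [mul_div_assoc, div_self ha.ne', mul_one] at h2
  rw [intervalIntegral.integral_eq_sub_of_hasDerivAt hd (hc.intervalIntegrable _ _)]
  have : 0 ≤ Real.exp (-(a * (1 - 0))) / a := by positivity
  simp only [sub_self, mul_zero, neg_zero, Real.exp_zero]
  linarith

lemma lintegral_prod_pi_muW {V : Type} [Fintype V] (e : Finset V) (g : V → ℝ → ENNReal)
    (hg : ∀ v, Measurable (g v)) :
    ∫⁻ w, ∏ v ∈ e, g v (w v) ∂(Measure.pi fun _ : V => muW) =
      ∏ v ∈ e, ∫⁻ x, g v x ∂muW := by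
  refine (ProbabilityTheory.lintegral_prod_eq_prod_lintegral_of_indepFun e
    (fun v (w : V → ℝ) => g v (w v))
    (ProbabilityTheory.iIndepFun_pi (μ := fun _ : V => muW) fun v => (hg v).aemeasurable)
    (fun v => (hg v).comp (measurable_pi_apply v))).trans ?_
  refine Finset.prod_congr rfl fun v _ => ?_
  exact (measurePreserving_eval (fun _ : V => muW) v).lintegral_comp (hg v)

end Integration

section Probability

variable {V : Type} [Fintype V] [DecidableEq V]

lemma lintegral_threats_le (E : Finset (Finset V)) (e : Finset V) (ic : V → Bool) :
    ∫⁻ w, (∏ v ∈ e, if ic v = true then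
        ∑ f ∈ threats E e ic v, ENNReal.ofReal (Real.exp (-(((f.card : ℝ) + 1) * (1 - w v))))
        else 1) ∂(Measure.pi fun _ : V => muW) ≤
      ENNReal.ofReal (∏ v ∈ e, if ic v = true then threatLoad E e ic v else 1) := by
  have hm : ∀ a : ℝ, Measurable fun x : ℝ => ENNReal.ofReal (Real.exp (-(a * (1 - x)))) :=
    fun a => by fun_prop
  rw [lintegral_prod_pi_muW e (fun v x => if ic v = true then
    ∑ f ∈ threats E e ic v, ENNReal.ofReal (Real.exp (-(((f.card : ℝ) + 1) * (1 - x)))) else 1)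
    fun v => by
      split_ifs
      · exact Finset.measurable_fun_sum _ fun f _ => hm _
      · exact measurable_const,
    ENNReal.ofReal_prod_of_nonneg fun v _ => by
      split_ifs
      · exact threatLoad_nonneg v
      · exact zero_le_one]
  refine Finset.prod_le_prod' fun v _ => ?_
  split_ifs
  · rw [lintegral_finsetSum _ fun f _ => hm _, threatLoad,
      ENNReal.ofReal_sum_of_nonneg fun _ _ => by positivity]
    exact Finset.sum_le_sum fun f _ => lintegral_exp_muW_le (by positivity)
  · simp

theorem muH_final_red_le {E : Finset (Finset V)} {k : ℕ} (hk : 0 < k)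
    (hE2 : ∀ f ∈ E, 2 ≤ f.card) (hEk : ∀ f ∈ E, k ≤ f.card)
    {C : (V → Bool) → (V → ℝ) → (V → Bool)}
    (hC : ∀ ic w, Function.Injective w → IsFinalColoring E ic w (C ic w))
    {e : Finset V} (he : e ∈ E) (aC aD q : ℝ) :
    muH V {ω | (∀ v ∈ e, C ω.1 ω.2 v = false) ∧ ¬ BadC E aC q ω.1 ∧ ¬ BadD E aD q ω.1 ω.2} ≤
      ENNReal.ofReal (Real.exp (aD * q) * Real.exp (aC * q) * (qH E / k) / 2 ^ e.card) := by
  let P : (V → Bool) → Prop := fun ic =>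
    (∃ v ∈ e, ic v = true) ∧ ∑ v ∈ e, threatLoad E e ic v ≤ aC * q
  let T : (V → Bool) → (V → ℝ) → ENNReal := fun ic w => ∏ v ∈ e, if ic v = true then
    ∑ f ∈ threats E e ic v, ENNReal.ofReal (Real.exp (-(((f.card : ℝ) + 1) * (1 - w v)))) else 1
  let g : (V → Bool) × (V → ℝ) → ENNReal := fun ω =>
    ENNReal.ofReal (Real.exp (aD * q)) * if P ω.1 then T ω.1 ω.2 else 0
  have hTm : ∀ ic, Measurable (T ic) := fun ic => by
    refine Finset.measurable_fun_prod _ fun v _ => ?_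
    split_ifs
    · exact Finset.measurable_fun_sum _ fun f _ => by fun_prop
    · exact measurable_const
  have hg : Measurable g := by
    refine measurable_from_prod_countable_right fun ic => Measurable.const_mul ?_ _
    dsimp only
    split_ifs
    · exact hTm ic
    · exact measurable_const
  have hae : ∀ᵐ ω ∂(muH V), Function.Injective ω.2 ∧ ∀ v, ω.2 v < 1 :=
    Measure.quasiMeasurePreserving_snd.ae (ae_injective_and_lt_one V)
  have hsub : muH V {ω | (∀ v ∈ e, C ω.1 ω.2 v = false) ∧ ¬ BadC E aC q ω.1 ∧
      ¬ BadD E aD q ω.1 ω.2} ≤ muH V {ω | 1 ≤ g ω} := by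
    refine measure_mono_ae ?_
    filter_upwards [hae] with ω ⟨hinj, hlt⟩ ⟨hred, hnC, hnD⟩
    have hfin := hC ω.1 ω.2 hinj
    have hP : P ω.1 := ⟨exists_blue_of_final_red hfin he
      (Finset.card_pos.1 (by have := hE2 e he; omega)) hred, sum_threatLoad_le hE2 (not_lt.1 hnC)⟩
    have h1 := ENNReal.ofReal_le_ofReal
      (one_le_exp_mul_prod hE2 hlt hfin hred (B := aD * q) (not_lt.1 hnD))
    rw [ENNReal.ofReal_one, ENNReal.ofReal_mul (Real.exp_pos _).le,
      ENNReal.ofReal_prod_of_nonneg fun v _ => by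
        split_ifs
        · exact Finset.sum_nonneg fun _ _ => (Real.exp_pos _).le
        · exact zero_le_one] at h1
    refine h1.trans (le_of_eq ?_)
    simp only [g, if_pos hP, T]
    congr 1
    refine Finset.prod_congr rfl fun v _ => ?_
    split_ifs
    · exact ENNReal.ofReal_sum_of_nonneg fun _ _ => (Real.exp_pos _).le
    · exact ENNReal.ofReal_one
  have hR0 : ∀ ic : V → Bool, 0 ≤ if P ic then
      ∏ v ∈ e, (if ic v = true then threatLoad E e ic v else 1) else 0 := fun ic => by
    split_ifs
    · exact Finset.prod_nonneg fun v _ => by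
        split_ifs
        · exact threatLoad_nonneg v
        · exact zero_le_one
    · exact le_rfl
  calc _ ≤ muH V {ω | 1 ≤ g ω} := hsub
    _ ≤ ∫⁻ ω, g ω ∂(muH V) := by simpa using mul_meas_ge_le_lintegral hg 1
    _ = ∑ ic : V → Bool, (∫⁻ w, g (ic, w) ∂(Measure.pi fun _ : V => muW)) *
          ENNReal.ofReal (1 / 2 ^ Fintype.card V) := by
        rw [muH, lintegral_prod _ hg.aemeasurable, lintegral_fintype]
        simp only [pi_muBool_singleton]
    _ ≤ ∑ ic : V → Bool, ENNReal.ofReal (Real.exp (aD * q) * (if P ic then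
          ∏ v ∈ e, (if ic v = true then threatLoad E e ic v else 1) else 0) *
            (1 / 2 ^ Fintype.card V)) := by
        refine Finset.sum_le_sum fun ic _ => ?_
        rw [ENNReal.ofReal_mul (mul_nonneg (Real.exp_pos _).le (hR0 ic)),
          ENNReal.ofReal_mul (Real.exp_pos _).le]
        gcongr
        simp only [g]
        split_ifs
        · rw [lintegral_const_mul _ (hTm ic)]
          gcongr
          exact lintegral_threats_le E e ic
        · simp
    _ = ENNReal.ofReal (Real.exp (aD * q) * (1 / 2 ^ Fintype.card V) *
          ∑ ic : V → Bool, if P ic then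
          ∏ v ∈ e, (if ic v = true then threatLoad E e ic v else 1) else 0) := by
        rw [← ENNReal.ofReal_sum_of_nonneg fun ic _ =>
          mul_nonneg (mul_nonneg (Real.exp_pos _).le (hR0 ic)) (by positivity), Finset.mul_sum]
        congr 1
        exact Finset.sum_congr rfl fun _ _ => by ring
    _ ≤ _ := by
        refine ENNReal.ofReal_le_ofReal ?_
        have h1 := sum_colorings_le e (fun ic => threatLoad E e ic)
          (fun _ v => threatLoad_nonneg v) (fun _ _ h v => threatLoad_congr h v) (aC * q)
        have h2 := sum_threatLoad_colorings_le hk E hEk e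
        rw [le_div_iff₀ (by positivity)]
        calc _ = Real.exp (aD * q) * (1 / 2 ^ Fintype.card V) * (2 ^ e.card *
              ∑ ic : V → Bool, if P ic then
              ∏ v ∈ e, (if ic v = true then threatLoad E e ic v else 1) else 0) := by ring
          _ ≤ Real.exp (aD * q) * (1 / 2 ^ Fintype.card V) *
              (Real.exp (aC * q) * (2 ^ Fintype.card V * (qH E / k))) := by
              refine mul_le_mul_of_nonneg_left (h1.trans ?_) (by positivity)
              gcongr
          _ = _ := by field_simp

end Probability

/-- The numerical estimate behind the choice `αC = αD = 12`, `δ = 1 / 50`. -/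
lemma three_mul_sq_mul_exp_le {q k : ℝ} (hk : 9 ≤ k) (hq : 0 ≤ q)
    (hqk : q ≤ 1 / 50 * Real.log k) : 3 * q ^ 2 * Real.exp (24 * q) ≤ 2 * k := by
  have h1 : q ^ 2 / 2 ≤ Real.exp q := by
    have := Real.quadratic_le_exp_of_nonneg hq
    linarith
  have h2 : Real.exp (25 * q) ≤ √k := by
    rw [Real.sqrt_eq_rpow, Real.rpow_def_of_pos (by linarith)]
    exact Real.exp_le_exp.2 (by linarith)
  have h3 : Real.exp (25 * q) = Real.exp q * Real.exp (24 * q) := by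
    rw [← Real.exp_add]; ring_nf
  have h4 : 3 ≤ √k := Real.le_sqrt_of_sq_le (by linarith)
  have h5 : √k * √k = k := Real.mul_self_sqrt (by linarith)
  have h6 : q ^ 2 / 2 * Real.exp (24 * q) ≤ √k := by
    refine le_trans ?_ h2
    rw [h3]
    gcongr
  nlinarith

/-- Improved bound (Proposition 2.3): there are constants `δ, αA, αB, αC, αD > 0` such that
for all sufficiently large `k`, for every hypergraph with `s_min(H) ≥ k` and
`1 ≤ q(H) ≤ δ·log k` and every edge `e`, the probability that all of `e` gets final color
red while none of the bad events `A, B, C, D` occurs is at most `1/(3·q·2^{|e|−1})`. -/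
theorem red_edge_probability_improved :
    ∃ δ aA aB aC aD : ℝ, 0 < δ ∧ 0 < aA ∧ 0 < aB ∧ 0 < aC ∧ 0 < aD ∧
      ∃ k0 : ℕ, ∀ k : ℕ, k0 ≤ k →
        ∀ (V : Type) [Fintype V] [DecidableEq V] (E : Finset (Finset V)),
          (∀ f ∈ E, 2 ≤ f.card) → (∀ f ∈ E, k ≤ f.card) →
          1 ≤ qH E → qH E ≤ δ * Real.log k →
          ∀ C : (V → Bool) → (V → ℝ) → (V → Bool),
            (∀ ic w, Function.Injective w → IsFinalColoring E ic w (C ic w)) →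
            ∀ e ∈ E,
              muH V {ω : (V → Bool) × (V → ℝ) |
                  (∀ v ∈ e, C ω.1 ω.2 v = false) ∧
                  ¬ BadA E aA (qH E) ω.1 ∧ ¬ BadB E aB (qH E) ω.1 ω.2 ∧
                  ¬ BadC E aC (qH E) ω.1 ∧ ¬ BadD E aD (qH E) ω.1 ω.2} ≤
                ENNReal.ofReal (1 / (3 * qH E * 2 ^ (e.card - 1))) := by
  refine ⟨1 / 50, 12, 12, 12, 12, by norm_num, by norm_num, by norm_num, by norm_num,
    by norm_num, 9, ?_⟩
  intro k hk V _ _ E hE2 hEk hq1 hqk C hC e he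
  have hk' : (9 : ℝ) ≤ k := by exact_mod_cast hk
  refine (measure_mono fun ω hω => ?_).trans
    ((muH_final_red_le (by omega) hE2 hEk hC he 12 12 (qH E)).trans
      (ENNReal.ofReal_le_ofReal ?_))
  · exact ⟨hω.1, hω.2.2.2.1, hω.2.2.2.2⟩
  · have hnum := three_mul_sq_mul_exp_le hk' (by linarith) hqk
    have hexp : Real.exp (12 * qH E) * Real.exp (12 * qH E) = Real.exp (24 * qH E) := by
      rw [← Real.exp_add]; ring_nf
    have hcard : (2 : ℝ) ^ e.card = 2 * 2 ^ (e.card - 1) := by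
      rw [← pow_succ']
      congr 1
      have := hE2 e he
      omega
    set q := qH E
    have hq0 : 0 < q := by linarith
    have hk0 : (0 : ℝ) < k := by linarith
    rw [hexp, hcard, div_le_div_iff₀ (by positivity) (by positivity), ← mul_div_assoc,
      div_mul_eq_mul_div, div_le_iff₀ hk0]
    have h2 : (0 : ℝ) < 2 ^ (e.card - 1) := by positivity
    nlinarith [mul_le_mul_of_nonneg_right hnum h2.le]
end

section
/- There exist constants δ > 0 and α_A, α_B, α_C > 0 such that for all sufficiently large k the following holds: for every hypergraph H=(V,E) with s_min(H) ≥ k and 1 ≤ q(H) ≤ δ·log k/log log k, and for every edge e ∈ E, in the random two-phase coloring the probability that all vertices of e receive final color red and none of the bad events A, B, C occurs is at most 1/(3·q(H)·2^{|e|−1}). -/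
open MeasureTheory Finset
open scoped Classical

section RedEdge

variable {V : Type} [DecidableEq V]

/-- The part of `e` coloured blue by `ic`. -/
noncomputable def bluePart (e : Finset V) (ic : V → Bool) : Finset V :=
  e.filter fun v => ic v = true

/-- The edges whose vertices outside `e` are all blue. -/
noncomputable def blueOutside (E : Finset (Finset V)) (e : Finset V) (ic : V → Bool) :
    Finset (Finset V) :=
  E.filter fun g => ∀ u ∈ g, u ∉ e → ic u = true

/-- Total weight `L / |g|` of the edges `g ∈ F` through `v` that meet `e` inside `T ∪ {v}`. -/
noncomputable def stepWeight (e : Finset V) (F : Finset (Finset V)) (L : ℝ) (T : Finset V)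
    (v : V) : ℝ :=
  ∑ g ∈ F with v ∈ g ∧ g ∩ e ⊆ insert v T, L / (g.card : ℝ)

/-- Sum, over all orderings of an `n`-element set `S`, of the product of the step weights. -/
noncomputable def orderWeight (e : Finset V) (F : Finset (Finset V)) (L : ℝ) :
    ℕ → Finset V → ℝ
  | 0, _ => 1
  | n + 1, S => ∑ v ∈ S, orderWeight e F L n (S.erase v) * stepWeight e F L (S.erase v) v

lemma stepWeight_nonneg (e : Finset V) (F : Finset (Finset V)) {L : ℝ} (hL : 0 ≤ L)
    (T : Finset V) (v : V) : 0 ≤ stepWeight e F L T v :=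
  Finset.sum_nonneg fun _ _ => by positivity

lemma orderWeight_nonneg (e : Finset V) (F : Finset (Finset V)) {L : ℝ} (hL : 0 ≤ L)
    (n : ℕ) (S : Finset V) : 0 ≤ orderWeight e F L n S := by
  induction n generalizing S with
  | zero => simp [orderWeight]
  | succ n ih =>
    exact Finset.sum_nonneg fun v _ => mul_nonneg (ih _) (stepWeight_nonneg e F hL _ v)

instance inst_s3 : IsProbabilityMeasure muW := ⟨by simp [muW]⟩

instance inst_s3_2 : IsProbabilityMeasure muBool := by
  unfold muBool; infer_instance

lemma muW_Ici_le (x : ℝ) : muW (Set.Ici (1 - x)) ≤ ENNReal.ofReal x := by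
  have h : Set.Ici (1 - x) ∩ Set.Ioo 0 1 ⊆ Set.Icc (1 - x) 1 := fun t ht => ⟨ht.1, ht.2.2.le⟩
  calc muW (Set.Ici (1 - x)) = volume (Set.Ici (1 - x) ∩ Set.Ioo 0 1) := by
        rw [muW, Measure.restrict_apply measurableSet_Ici]
    _ ≤ volume (Set.Icc (1 - x) 1) := measure_mono h
    _ = ENNReal.ofReal x := by rw [Real.volume_Icc]; congr 1; ring

/-- Recursive bound for the probability that every vertex of `S` is the heaviest vertex of some
edge of `F` within `e` and is heavy enough. -/
lemma measure_reasons_le [Fintype V] (e : Finset V) (F : Finset (Finset V)) {L : ℝ} (hL : 0 ≤ L)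
    (n : ℕ) (S : Finset V) (hS : S.card = n) (K : V → Set ℝ) :
    (Measure.pi fun _ : V => muW) {w | Function.Injective w ∧
      (∀ v ∈ S, ∃ g ∈ F, v ∈ g ∧ g ∩ e ⊆ S ∧ (∀ u ∈ g, w u ≤ w v) ∧
        1 - L / (g.card : ℝ) ≤ w v) ∧ ∀ v ∉ S, w v ∈ K v} ≤
      ENNReal.ofReal (orderWeight e F L n S) * ∏ v ∈ Sᶜ, muW (K v) := by
  induction n generalizing S K with
  | zero =>
    obtain rfl := Finset.card_eq_zero.mp hS
    simp only [orderWeight, ENNReal.ofReal_one, one_mul, Finset.compl_empty]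
    rw [← Measure.pi_pi]
    refine measure_mono fun w hw v _ => hw.2.2 v (by simp)
  | succ n ih =>
    set B : V → Set ℝ := fun v =>
      ⋃ g ∈ F.filter (fun g => v ∈ g ∧ g ∩ e ⊆ insert v (S.erase v)),
        Set.Ici (1 - L / (g.card : ℝ)) with hB
    have hBle : ∀ v, muW (B v) ≤ ENNReal.ofReal (stepWeight e F L (S.erase v) v) := by
      intro v
      refine (measure_biUnion_finset_le _ _).trans ?_
      rw [stepWeight, ENNReal.ofReal_sum_of_nonneg fun _ _ => by positivity]
      exact Finset.sum_le_sum fun g _ => muW_Ici_le _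
    have hsub : {w : V → ℝ | Function.Injective w ∧
        (∀ v ∈ S, ∃ g ∈ F, v ∈ g ∧ g ∩ e ⊆ S ∧ (∀ u ∈ g, w u ≤ w v) ∧
          1 - L / (g.card : ℝ) ≤ w v) ∧ ∀ v ∉ S, w v ∈ K v} ⊆
        ⋃ v ∈ S, {w | Function.Injective w ∧
          (∀ u ∈ S.erase v, ∃ g ∈ F, u ∈ g ∧ g ∩ e ⊆ S.erase v ∧ (∀ x ∈ g, w x ≤ w u) ∧
            1 - L / (g.card : ℝ) ≤ w u) ∧
          ∀ u ∉ S.erase v, w u ∈ Function.update K v (B v) u} := by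
      rintro w ⟨hinj, hr, hK⟩
      have hne : S.Nonempty := Finset.card_pos.mp (by omega)
      obtain ⟨v, hv, hmax⟩ := Finset.exists_max_image S w hne
      simp only [Set.mem_iUnion]
      refine ⟨v, hv, hinj, ?_, ?_⟩
      · intro u hu
        obtain ⟨huv, huS⟩ := Finset.mem_erase.mp hu
        obtain ⟨g, hg, hug, hgS, hgm, hgw⟩ := hr u huS
        refine ⟨g, hg, hug, ?_, hgm, hgw⟩
        intro x hx
        refine Finset.mem_erase.mpr ⟨?_, hgS hx⟩
        rintro rfl
        exact huv (hinj (le_antisymm (hmax u huS) (hgm x (Finset.mem_inter.mp hx).1)))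
      · intro u hu
        by_cases huv : u = v
        · subst huv
          obtain ⟨g, hg, hug, hgS, -, hgw⟩ := hr u hv
          simp only [Function.update_self, hB, Set.mem_iUnion, Finset.mem_filter]
          exact ⟨g, ⟨hg, hug, by rwa [Finset.insert_erase hv]⟩, hgw⟩
        · rw [Function.update_of_ne huv]
          exact hK u fun h => hu (Finset.mem_erase.mpr ⟨huv, h⟩)
    refine (measure_mono hsub).trans ((measure_biUnion_finset_le _ _).trans ?_)
    rw [orderWeight, ENNReal.ofReal_sum_of_nonneg fun v _ =>
      mul_nonneg (orderWeight_nonneg e F hL _ _) (stepWeight_nonneg e F hL _ v), Finset.sum_mul]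
    refine Finset.sum_le_sum fun v hv => ?_
    refine (ih (S.erase v) (by rw [Finset.card_erase_of_mem hv]; omega) _).trans ?_
    rw [Finset.compl_erase, Finset.prod_insert (by simpa using hv), Function.update_self,
      ENNReal.ofReal_mul (orderWeight_nonneg e F hL _ _), mul_assoc]
    have hprod : ∏ u ∈ Sᶜ, muW (Function.update K v (B v) u) = ∏ u ∈ Sᶜ, muW (K u) := by
      refine Finset.prod_congr rfl fun u hu => ?_
      rw [Function.update_of_ne]
      rintro rfl
      exact (Finset.mem_compl.mp hu) hv
    rw [hprod]
    gcongr
    exact hBle v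

lemma sum_stepWeight_le (e : Finset V) (F : Finset (Finset V)) {L : ℝ} (hL : 0 ≤ L)
    (T : Finset V) :
    ∑ v ∈ e \ T, stepWeight e F L T v ≤
      ∑ g ∈ F with ((g ∩ e) \ T).card = 1, L / (g.card : ℝ) := by
  simp only [stepWeight, Finset.sum_filter]
  rw [Finset.sum_comm]
  refine Finset.sum_le_sum fun g _ => ?_
  rw [← Finset.sum_filter, Finset.sum_const, nsmul_eq_mul]
  have hset : ∀ v ∈ (e \ T).filter (fun v => v ∈ g ∧ g ∩ e ⊆ insert v T),
      (g ∩ e) \ T = {v} := by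
    intro v hv
    simp only [Finset.mem_filter, Finset.mem_sdiff] at hv
    ext x
    simp only [Finset.mem_sdiff, Finset.mem_inter, Finset.mem_singleton]
    constructor
    · rintro ⟨hx, hxT⟩
      have := hv.2.2 (Finset.mem_inter.mpr hx)
      exact (Finset.mem_insert.mp this).resolve_right hxT
    · rintro rfl
      exact ⟨⟨hv.2.1, hv.1.1⟩, hv.1.2⟩
  have hg : 0 ≤ L / (g.card : ℝ) := by positivity
  by_cases hne : ((e \ T).filter (fun v => v ∈ g ∧ g ∩ e ⊆ insert v T)).Nonempty
  · obtain ⟨v, hv⟩ := hne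
    have h1 : ((e \ T).filter (fun v => v ∈ g ∧ g ∩ e ⊆ insert v T)).card ≤ 1 := by
      refine Finset.card_le_one.mpr fun a ha b hb => ?_
      exact Finset.singleton_injective ((hset a ha).symm.trans (hset b hb))
    rw [if_pos (by rw [hset v hv]; simp)]
    exact mul_le_of_le_one_left hg (by exact_mod_cast h1)
  · rw [Finset.not_nonempty_iff_eq_empty.mp hne]
    split_ifs <;> simp [hg]

/-- Summing over sets by removing a marked element. -/
lemma sum_erase_le (e : Finset V) (P : Finset V → Prop) (hP : ∀ S T, T ⊆ S → P S → P T)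
    (f : Finset V → V → ℝ) (hf : ∀ T v, 0 ≤ f T v) (n : ℕ) :
    ∑ S ∈ (e.powersetCard (n + 1)).filter P, ∑ v ∈ S, f (S.erase v) v ≤
      ∑ T ∈ (e.powersetCard n).filter P, ∑ v ∈ e \ T, f T v := by
  rw [Finset.sum_sigma', Finset.sum_sigma']
  let φ : (Σ _ : Finset V, V) → (Σ _ : Finset V, V) := fun p => ⟨p.1.erase p.2, p.2⟩
  set A := ((e.powersetCard (n + 1)).filter P).sigma fun S => S with hA
  have hinj : Set.InjOn φ A := by
    rintro ⟨S, v⟩ hS ⟨S', v'⟩ hS' h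
    simp only [hA, Finset.coe_sigma, Set.mem_sigma_iff, Finset.mem_coe] at hS hS'
    simp only [φ, Sigma.mk.injEq, heq_eq_eq] at h
    obtain ⟨h1, rfl⟩ := h
    have : S = S' := by rw [← Finset.insert_erase hS.2, h1, Finset.insert_erase hS'.2]
    rw [this]
  rw [← Finset.sum_image (f := fun p : (Σ _ : Finset V, V) => f p.1 p.2) hinj]
  refine Finset.sum_le_sum_of_subset_of_nonneg ?_ fun p _ _ => hf _ _
  intro p hp
  obtain ⟨⟨S, v⟩, hS, rfl⟩ := Finset.mem_image.mp hp
  simp only [hA, Finset.mem_sigma, Finset.mem_filter, Finset.mem_powersetCard] at hS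
  simp only [φ, Finset.mem_sigma, Finset.mem_filter, Finset.mem_powersetCard, Finset.mem_sdiff]
  refine ⟨⟨⟨(Finset.erase_subset _ _).trans hS.1.1.1, ?_⟩, hP _ _ (Finset.erase_subset _ _) hS.1.2⟩,
    hS.1.1.1 hS.2, Finset.notMem_erase _ _⟩
  rw [Finset.card_erase_of_mem hS.2, hS.1.1.2, Nat.add_sub_cancel]

/-- `S` leaves only a small total weight of edges of `F` with at most one vertex in `e \ S`. -/
def Sparse (e : Finset V) (F : Finset (Finset V)) (q : ℝ) (S : Finset V) : Prop :=
  ∑ g ∈ F with ((g ∩ e) \ S).card ≤ 1, (1 : ℝ) / (g.card : ℝ) ≤ q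

lemma Sparse.subset {e : Finset V} {F : Finset (Finset V)} {q : ℝ} {S T : Finset V}
    (hTS : T ⊆ S) (hS : Sparse e F q S) : Sparse e F q T := by
  refine le_trans (Finset.sum_le_sum_of_subset_of_nonneg ?_ fun _ _ _ => by positivity) hS
  intro g hg
  simp only [Finset.mem_filter] at hg ⊢
  exact ⟨hg.1, (Finset.card_le_card (Finset.sdiff_subset_sdiff le_rfl hTS)).trans hg.2⟩

lemma Sparse.sum_stepWeight_le {e : Finset V} {F : Finset (Finset V)} {q L : ℝ} (hL : 0 ≤ L)
    {T : Finset V} (hT : Sparse e F q T) : ∑ v ∈ e \ T, stepWeight e F L T v ≤ L * q := by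
  refine (_root_.sum_stepWeight_le e F hL T).trans ?_
  calc ∑ g ∈ F with ((g ∩ e) \ T).card = 1, L / (g.card : ℝ)
      ≤ ∑ g ∈ F with ((g ∩ e) \ T).card ≤ 1, L / (g.card : ℝ) := by
        refine Finset.sum_le_sum_of_subset_of_nonneg ?_ fun _ _ _ => by positivity
        intro g hg
        simp only [Finset.mem_filter] at hg ⊢
        exact ⟨hg.1, hg.2.le⟩
    _ = L * ∑ g ∈ F with ((g ∩ e) \ T).card ≤ 1, (1 : ℝ) / (g.card : ℝ) := by
        rw [Finset.mul_sum]
        exact Finset.sum_congr rfl fun g _ => by ring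
    _ ≤ L * q := mul_le_mul_of_nonneg_left hT hL

lemma sum_orderWeight_le (e : Finset V) (F : Finset (Finset V)) {L q : ℝ} (hL : 0 ≤ L)
    (hq : 0 ≤ q) (n : ℕ) :
    ∑ S ∈ (e.powersetCard (n + 1)).filter (Sparse e F q), orderWeight e F L (n + 1) S ≤
      (∑ g ∈ F with (g ∩ e).card = 1, L / (g.card : ℝ)) * (L * q) ^ n := by
  have step : ∀ n, ∑ S ∈ (e.powersetCard (n + 1)).filter (Sparse e F q),
      orderWeight e F L (n + 1) S ≤ ∑ T ∈ (e.powersetCard n).filter (Sparse e F q),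
        orderWeight e F L n T * ∑ v ∈ e \ T, stepWeight e F L T v := by
    intro n
    simp only [Finset.mul_sum]
    exact sum_erase_le e (Sparse e F q) (fun S T h hS => hS.subset h)
      (fun T v => orderWeight e F L n T * stepWeight e F L T v)
      (fun T v => mul_nonneg (orderWeight_nonneg e F hL _ _) (stepWeight_nonneg e F hL _ _)) n
  have h0 : 0 ≤ ∑ g ∈ F with (g ∩ e).card = 1, L / (g.card : ℝ) :=
    Finset.sum_nonneg fun _ _ => by positivity
  induction n with
  | zero =>
    refine (step 0).trans ?_
    rw [Finset.powersetCard_zero, Finset.filter_singleton]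
    split_ifs
    · simpa [orderWeight] using sum_stepWeight_le e F hL ∅
    · simpa using h0
  | succ n ih =>
    refine (step (n + 1)).trans ?_
    calc _ ≤ ∑ T ∈ (e.powersetCard (n + 1)).filter (Sparse e F q),
          orderWeight e F L (n + 1) T * (L * q) :=
          Finset.sum_le_sum fun T hT => mul_le_mul_of_nonneg_left
            ((Finset.mem_filter.mp hT).2.sum_stepWeight_le hL) (orderWeight_nonneg e F hL _ _)
      _ ≤ _ := by
          rw [← Finset.sum_mul, pow_succ, ← mul_assoc _ _ (L * q)]
          exact mul_le_mul_of_nonneg_right ih (by positivity)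

/-- The colours inside `e` are independent of the colours outside `e`. -/
lemma two_pow_mul_sum_bluePart_eq [Fintype V] (e S : Finset V) (hS : S ⊆ e) (h : (V → Bool) → ℝ)
    (hh : ∀ ic ic', (∀ v ∉ e, ic v = ic' v) → h ic = h ic') :
    (2 : ℝ) ^ e.card * ∑ ic with bluePart e ic = S, h ic = ∑ ic, h ic := by
  let ov : Finset V → (V → Bool) → V → Bool := fun S ic v => if v ∈ e then decide (v ∈ S) else ic v
  have hov : ∀ S ⊆ e, ∀ ic, bluePart e (ov S ic) = S := by
    intro S hS ic
    ext v
    simp only [bluePart, ov, Finset.mem_filter]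
    constructor
    · rintro ⟨h1, h2⟩
      simpa [h1] using h2
    · intro hv
      simp [hS hv, hv]
  have hback : ∀ S S' ic, bluePart e ic = S → ov S (ov S' ic) = ic := by
    rintro S S' ic rfl
    funext v
    by_cases hv : v ∈ e
    · cases hb : ic v <;> simp [ov, bluePart, hv, hb]
    · simp [ov, hv]
  have hconst : ∀ S' ∈ e.powerset,
      ∑ ic with bluePart e ic = S', h ic = ∑ ic with bluePart e ic = S, h ic := by
    intro S' hS'
    refine Finset.sum_nbij' (ov S) (ov S') ?_ ?_ ?_ ?_ ?_
    · intro ic _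
      simp [hov S hS]
    · intro ic _
      simp [hov S' (Finset.mem_powerset.mp hS')]
    · intro ic hic
      exact hback _ _ _ (Finset.mem_filter.mp hic).2
    · intro ic hic
      exact hback _ _ _ (Finset.mem_filter.mp hic).2
    · intro ic _
      exact hh _ _ fun v hv => by simp [ov, hv]
  rw [← Finset.sum_fiberwise_of_maps_to (s := Finset.univ) (t := e.powerset) (g := bluePart e)
    (fun ic _ => Finset.mem_powerset.mpr (Finset.filter_subset _ _)),
    Finset.sum_congr rfl hconst, Finset.sum_const, Finset.card_powerset, nsmul_eq_mul]
  push_cast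
  rfl

lemma sum_bluePart_eq [Fintype V] (e : Finset V) (G : (V → Bool) → Finset V → ℝ)
    (hG : ∀ S ic ic', (∀ v ∉ e, ic v = ic' v) → G ic S = G ic' S) :
    ∑ ic, G ic (bluePart e ic) = (∑ ic, ∑ S ∈ e.powerset, G ic S) / 2 ^ e.card := by
  rw [eq_div_iff (by positivity), mul_comm,
    ← Finset.sum_fiberwise_of_maps_to (s := Finset.univ) (t := e.powerset) (g := bluePart e)
    (fun ic _ => Finset.mem_powerset.mpr (Finset.filter_subset _ _)), Finset.mul_sum,
    Finset.sum_comm]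
  refine Finset.sum_congr rfl fun S hS => ?_
  rw [← two_pow_mul_sum_bluePart_eq e S (Finset.mem_powerset.mp hS) (fun ic => G ic S) (hG S)]
  congr 1
  refine Finset.sum_congr rfl fun ic hic => ?_
  rw [(Finset.mem_filter.mp hic).2]

lemma sum_blueOutside_le [Fintype V] (E : Finset (Finset V)) (e : Finset V) {L : ℝ}
    (hL : 0 ≤ L) {k : ℕ} (hk : 0 < k) (hE : ∀ f ∈ E, k ≤ f.card) :
    ∑ ic : V → Bool, ∑ g ∈ blueOutside E e ic with (g ∩ e).card = 1, L / (g.card : ℝ) ≤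
      2 ^ Fintype.card V * (L * qH E / k) := by
  have hcount : ∀ g : Finset V, ∑ ic : V → Bool,
      (if ∀ u ∈ g, u ∉ e → ic u = true then (1 : ℝ) else 0) =
        2 ^ Fintype.card V / 2 ^ (g \ e).card := by
    intro g
    have := two_pow_mul_sum_bluePart_eq (g \ e) (g \ e) le_rfl (fun _ => 1) (fun _ _ _ => rfl)
    rw [eq_div_iff (by positivity), mul_comm]
    rw [Finset.sum_filter] at this
    simp only [Finset.sum_const, Finset.card_univ, Fintype.card_fun, Fintype.card_bool,
      nsmul_eq_mul, mul_one] at this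
    push_cast at this
    rw [← this]
    congr 1
    refine Finset.sum_congr rfl fun ic _ => ?_
    congr 1
    simp [bluePart, Finset.filter_eq_self]
  simp only [blueOutside, Finset.sum_filter]
  rw [Finset.sum_comm, qH, Finset.mul_sum, Finset.sum_div, Finset.mul_sum]
  refine Finset.sum_le_sum fun g hg => ?_
  have hkg : (k : ℝ) ≤ g.card := by exact_mod_cast hE g hg
  have hk' : (0 : ℝ) < k := by exact_mod_cast hk
  by_cases h1 : (g ∩ e).card = 1
  · simp only [h1, if_true]
    have hc : (g \ e).card + 1 = g.card := by
      rw [← h1, Finset.card_sdiff_add_card_inter]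
    have hz : (2 : ℝ) ^ (1 - (g.card : ℤ)) = 1 / 2 ^ (g \ e).card := by
      rw [← hc]
      push_cast
      rw [show (1 : ℤ) - (((g \ e).card : ℤ) + 1) = -((g \ e).card : ℤ) by ring, zpow_neg,
        zpow_natCast, one_div]
    have : ∀ ic : V → Bool, (if ∀ u ∈ g, u ∉ e → ic u = true then L / (g.card : ℝ) else 0) =
        L / (g.card : ℝ) * (if ∀ u ∈ g, u ∉ e → ic u = true then (1 : ℝ) else 0) := by
      intro ic; split_ifs <;> simp
    rw [Finset.sum_congr rfl fun ic _ => this ic, ← Finset.mul_sum, hcount, hz]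
    have : L / (g.card : ℝ) ≤ L / k := div_le_div_of_nonneg_left hL hk' hkg
    calc _ ≤ L / k * (2 ^ Fintype.card V / 2 ^ (g \ e).card) := by gcongr
      _ = _ := by ring
  · simp only [h1, if_false]
    simp only [ite_self, Finset.sum_const_zero]
    positivity

lemma ae_injective [Fintype V] : ∀ᵐ w ∂(Measure.pi fun _ : V => muW), Function.Injective w := by
  have hac : (Measure.pi fun _ : V => muW) ≪ (volume : Measure (V → ℝ)) := by
    have : (Measure.pi fun _ : V => muW) =
        (volume : Measure (V → ℝ)).restrict (Set.univ.pi fun _ => Set.Ioo 0 1) := by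
      simp only [muW]
      rw [volume_pi, Measure.restrict_pi_pi]
    rw [this]
    exact Measure.absolutelyContinuous_of_le Measure.restrict_le_self
  have h : ∀ u v : V, u ≠ v → ∀ᵐ w ∂(Measure.pi fun _ : V => muW), w u ≠ w v := by
    intro u v huv
    refine hac.ae_le ?_
    let s : Submodule ℝ (V → ℝ) :=
      LinearMap.ker (LinearMap.proj (R := ℝ) (φ := fun _ : V => ℝ) u - LinearMap.proj v)
    have hs : s ≠ ⊤ := by
      intro htop
      have : (Pi.single u 1 : V → ℝ) ∈ s := by rw [htop]; trivial
      simp [s, LinearMap.mem_ker, huv.symm] at this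
    have := Measure.addHaar_submodule (volume : Measure (V → ℝ)) s hs
    refine measure_mono_null ?_ this
    intro w hw
    simpa [s, LinearMap.mem_ker, sub_eq_zero] using hw
  have hall : ∀ᵐ w ∂(Measure.pi fun _ : V => muW), ∀ u v : V, u ≠ v → w u ≠ w v := by
    rw [ae_all_iff]; intro u
    rw [ae_all_iff]; intro v
    by_cases huv : u = v
    · simp [huv]
    · filter_upwards [h u v huv] with w hw _ using hw
  filter_upwards [hall] with w hw u v huv
  by_contra hne
  exact hw u v hne huv

lemma muH_le_sum [Fintype V] (X : Set ((V → Bool) × (V → ℝ))) :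
    muH V X ≤ ∑ ic : V → Bool, ENNReal.ofReal (1 / 2 ^ Fintype.card V) *
      (Measure.pi fun _ : V => muW) {w | (ic, w) ∈ X} := by
  have hsub : X ⊆ ⋃ ic ∈ (Finset.univ : Finset (V → Bool)), {ic} ×ˢ {w | (ic, w) ∈ X} := by
    rintro ⟨ic, w⟩ h
    simpa using h
  refine (measure_mono hsub).trans ((measure_biUnion_finset_le _ _).trans ?_)
  refine Finset.sum_le_sum fun ic _ => ?_
  rw [muH, Measure.prod_prod]
  gcongr
  rw [Measure.pi_singleton]
  have : ∀ b : Bool, muBool {b} = 2⁻¹ := by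
    intro b
    rw [muBool, PMF.toMeasure_apply_singleton _ _ (measurableSet_singleton b)]
    simp
  simp only [this, Finset.prod_const, Finset.card_univ]
  rw [one_div, ENNReal.ofReal_inv_of_pos (by positivity), ENNReal.ofReal_pow (by norm_num),
    ENNReal.ofReal_ofNat, ENNReal.inv_pow]

/-- Combinatorial core: what the coloring looks like if all of `e` ends up red. -/
lemma red_edge_structure (E : Finset (Finset V)) (hE : ∀ f ∈ E, 2 ≤ f.card) {aA aB aC q : ℝ}
    {e : Finset V} (he : e ∈ E) {ic : V → Bool} {w : V → ℝ} {c : V → Bool}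
    (hc : IsFinalColoring E ic w c) (hred : ∀ v ∈ e, c v = false)
    (hA : ¬ BadA E aA q ic) (hB : ¬ BadB E aB q ic w) (hC : ¬ BadC E aC q ic) :
    (bluePart e ic).Nonempty ∧ ((bluePart e ic).card : ℝ) ≤ aA * q ∧
    Sparse e (blueOutside E e ic) (aC * q) (bluePart e ic) ∧
    ∀ v ∈ bluePart e ic, ∃ g ∈ blueOutside E e ic, v ∈ g ∧ g ∩ e ⊆ bluePart e ic ∧
      (∀ u ∈ g, w u ≤ w v) ∧ 1 - Real.log (aB * q) / (g.card : ℝ) ≤ w v := by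
  have hreason : ∀ v ∈ bluePart e ic, ∃ f ∈ E, v ∈ f ∧ (∀ u ∈ f, ic u = true) ∧
      (∀ u ∈ f, w u ≤ w v) ∧ ∀ u ∈ f, u ≠ v → c u = ic u := by
    intro v hv
    obtain ⟨hve, hvb⟩ := Finset.mem_filter.mp hv
    have : Reason E ic w c v := by
      by_contra hno
      have := (hc v).2 hno
      rw [hred v hve, hvb] at this
      exact Bool.false_ne_true this
    obtain ⟨f, hf, hvf, hm, hmax, hcol⟩ := this
    exact ⟨f, hf, hvf, fun u hu => (hm u hu v hvf).trans hvb, hmax, hcol⟩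
  refine ⟨?_, ?_, ?_, ?_⟩
  · by_contra hne
    rw [Finset.not_nonempty_iff_eq_empty, bluePart, Finset.filter_eq_empty_iff] at hne
    have hall : ∀ v ∈ e, ic v = false := fun v hv => by simpa using hne hv
    have hene : e.Nonempty := Finset.card_pos.mp (by have := hE e he; omega)
    obtain ⟨m, hm, hmax⟩ := Finset.exists_max_image e w hene
    have : Reason E ic w c m := ⟨e, he, hm, fun u hu v hv => by rw [hall u hu, hall v hv], hmax,
      fun u hu _ => by rw [hall u hu, hred u hu]⟩
    have := (hc m).1 this
    rw [hred m hm, hall m hm] at this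
    simp at this
  · rw [BadA, not_lt] at hA
    refine le_trans ?_ hA
    choose! f hf hvf hblue hmax hcol using hreason
    have : (bluePart e ic).card ≤ (E.filter fun f => Mono ic f).card := by
      refine Finset.card_le_card_of_injOn f ?_ ?_
      · intro v hv
        exact Finset.mem_filter.mpr ⟨hf v hv, fun u hu u' hu' => by
          rw [hblue v hv u hu, hblue v hv u' hu']⟩
      · intro v hv v' hv' h
        by_contra hne
        have hv1 := hvf v hv
        rw [h] at hv1
        obtain ⟨hve, hvb⟩ := Finset.mem_filter.mp hv
        have := hcol v' hv' v hv1 hne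
        rw [hred v hve, hvb] at this
        exact Bool.false_ne_true this
    exact_mod_cast this
  · rw [BadC, not_lt] at hC
    refine le_trans (Finset.sum_le_sum_of_subset_of_nonneg ?_ fun _ _ _ => by positivity) hC
    intro g hg
    simp only [blueOutside, Finset.mem_filter] at hg ⊢
    obtain ⟨⟨hgE, hgo⟩, hcard⟩ := hg
    refine ⟨hgE, ?_⟩
    have hgne : g.Nonempty := Finset.card_pos.mp (by have := hE g hgE; omega)
    have hout : ∀ u ∈ g, u ∉ (g ∩ e) \ bluePart e ic → ic u = true := by
      intro u hu hnot
      by_cases hue : u ∈ e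
      · by_contra hb
        exact hnot (by simp [bluePart, hu, hue, hb])
      · exact hgo u hu hue
    rcases Finset.eq_empty_or_nonempty ((g ∩ e) \ bluePart e ic) with h | ⟨v, hv⟩
    · obtain ⟨v, hv⟩ := hgne
      refine ⟨v, hv, fun u hu _ u' hu' _ => ?_⟩
      rw [hout u hu (by simp [h]), hout u' hu' (by simp [h])]
    · have huniq : ∀ u, u ≠ v → u ∉ (g ∩ e) \ bluePart e ic := fun u huv hu =>
        huv (Finset.card_le_one.mp hcard u hu v hv)
      refine ⟨v, (Finset.mem_inter.mp (Finset.mem_sdiff.mp hv).1).1, fun u hu hne u' hu' hne' => ?_⟩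
      rw [hout u hu (huniq u hne), hout u' hu' (huniq u' hne')]
  · intro v hv
    obtain ⟨f, hf, hvf, hblue, hmax, -⟩ := hreason v hv
    refine ⟨f, Finset.mem_filter.mpr ⟨hf, fun u hu _ => hblue u hu⟩, hvf, ?_, hmax, ?_⟩
    · intro u hu
      obtain ⟨h1, h2⟩ := Finset.mem_inter.mp hu
      exact Finset.mem_filter.mpr ⟨h2, hblue u h1⟩
    · by_contra hlt
      push Not at hlt
      exact hB ⟨f, hf, fun u hu u' hu' => by rw [hblue u hu, hblue u' hu'],
        fun u hu => (hmax u hu).trans_lt hlt⟩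

/-- Probability bound for `e` becoming red while no bad event occurs, before choosing the
parameters. -/
lemma muH_red_edge_le [Fintype V] (E : Finset (Finset V)) (hE : ∀ f ∈ E, 2 ≤ f.card) {aB : ℝ}
    {k : ℕ} (hk : 0 < k) (hkE : ∀ f ∈ E, k ≤ f.card) (hq : 0 ≤ qH E)
    (hL : 0 ≤ Real.log (aB * qH E)) (hM : 1 ≤ Real.log (aB * qH E) * qH E)
    (C : (V → Bool) → (V → ℝ) → (V → Bool))
    (hC : ∀ ic w, Function.Injective w → IsFinalColoring E ic w (C ic w))
    {e : Finset V} (he : e ∈ E) :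
    muH V {ω : (V → Bool) × (V → ℝ) | (∀ v ∈ e, C ω.1 ω.2 v = false) ∧
        ¬ BadA E 1 (qH E) ω.1 ∧ ¬ BadB E aB (qH E) ω.1 ω.2 ∧ ¬ BadC E 1 (qH E) ω.1} ≤
      ENNReal.ofReal (⌊qH E⌋₊ * (Real.log (aB * qH E) * qH E) ^ ⌊qH E⌋₊ *
        (Real.log (aB * qH E) * qH E / k) / 2 ^ e.card) := by
  set q := qH E with hqdef
  set L := Real.log (aB * q) with hLdef
  set N := ⌊q⌋₊ with hN
  let G : (V → Bool) → Finset V → ℝ := fun ic S =>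
    if S.Nonempty ∧ (S.card : ℝ) ≤ q ∧ Sparse e (blueOutside E e ic) q S then
      orderWeight e (blueOutside E e ic) L S.card S else 0
  have hG0 : ∀ ic S, 0 ≤ G ic S := by
    intro ic S
    simp only [G]
    split_ifs
    exacts [orderWeight_nonneg _ _ hL _ _, le_rfl]
  have hslice : ∀ ic : V → Bool, (Measure.pi fun _ : V => muW)
      {w | (ic, w) ∈ {ω : (V → Bool) × (V → ℝ) | (∀ v ∈ e, C ω.1 ω.2 v = false) ∧
        ¬ BadA E 1 q ω.1 ∧ ¬ BadB E aB q ω.1 ω.2 ∧ ¬ BadC E 1 q ω.1}} ≤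
      ENNReal.ofReal (G ic (bluePart e ic)) := by
    intro ic
    by_cases hgood : (bluePart e ic).Nonempty ∧ ((bluePart e ic).card : ℝ) ≤ q ∧
        Sparse e (blueOutside E e ic) q (bluePart e ic)
    · simp only [G, if_pos hgood]
      have := measure_reasons_le e (blueOutside E e ic) hL _ (bluePart e ic) rfl
        (fun _ => Set.univ)
      simp only [measure_univ, Finset.prod_const_one, mul_one] at this
      refine le_trans (measure_mono_ae ?_) this
      filter_upwards [ae_injective (V := V)] with w hw hX
      obtain ⟨hred, hA, hB, hCc⟩ := hX
      exact ⟨hw, (red_edge_structure E hE he (hC ic w hw) hred hA hB hCc).2.2.2,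
        fun _ _ => Set.mem_univ _⟩
    · refine le_trans (le_of_eq ?_) zero_le
      refine measure_mono_null (t := {w | ¬ Function.Injective w}) ?_ ae_injective
      rintro w ⟨hred, hA, hB, hCc⟩ hw
      have := red_edge_structure E hE he (hC ic w hw) hred hA hB hCc
      rw [one_mul] at this
      exact hgood ⟨this.1, this.2.1, by simpa using this.2.2.1⟩
  have hindep : ∀ S ic ic', (∀ v ∉ e, ic v = ic' v) → G ic S = G ic' S := by
    intro S ic ic' h
    have : blueOutside E e ic = blueOutside E e ic' := by
      ext g
      simp only [blueOutside, Finset.mem_filter]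
      refine and_congr_right fun _ => forall₂_congr fun u _ => forall_congr' fun hu => ?_
      rw [h u hu]
    simp only [G, this]
  let Z : (V → Bool) → ℝ := fun ic =>
    ∑ g ∈ blueOutside E e ic with (g ∩ e).card = 1, L / (g.card : ℝ)
  have hZ0 : ∀ ic, 0 ≤ Z ic := fun ic => Finset.sum_nonneg fun _ _ => by positivity
  have hGsum : ∀ ic, ∑ S ∈ e.powerset, G ic S ≤ N * (L * q) ^ N * Z ic := by
    intro ic
    have hle : ∀ S ∈ e.powerset, G ic S ≤ ∑ n ∈ Finset.range N,
        if S.card = n + 1 ∧ Sparse e (blueOutside E e ic) q S then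
          orderWeight e (blueOutside E e ic) L (n + 1) S else 0 := by
      intro S _
      have hnn : ∀ n ∈ Finset.range N,
          0 ≤ if S.card = n + 1 ∧ Sparse e (blueOutside E e ic) q S then
            orderWeight e (blueOutside E e ic) L (n + 1) S else 0 := by
        intro n _
        split_ifs
        exacts [orderWeight_nonneg _ _ hL _ _, le_rfl]
      by_cases hgood : S.Nonempty ∧ (S.card : ℝ) ≤ q ∧ Sparse e (blueOutside E e ic) q S
      · have hpos := hgood.1.card_pos
        have hcard : S.card ≤ N := Nat.le_floor hgood.2.1
        have hS : S.card = S.card - 1 + 1 := by omega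
        refine le_trans (le_of_eq ?_) (Finset.single_le_sum hnn
          (Finset.mem_range.mpr (show S.card - 1 < N by omega)))
        simp only [G]
        rw [if_pos hgood, if_pos ⟨hS, hgood.2.2⟩, ← hS]
      · simp only [G]
        rw [if_neg hgood]
        exact Finset.sum_nonneg hnn
    refine (Finset.sum_le_sum hle).trans ?_
    rw [Finset.sum_comm]
    calc _ ≤ ∑ n ∈ Finset.range N, (L * q) ^ N * Z ic := by
          refine Finset.sum_le_sum fun n hn => ?_
          rw [← Finset.sum_filter]
          have hset : e.powerset.filter
              (fun S => S.card = n + 1 ∧ Sparse e (blueOutside E e ic) q S) =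
              (e.powersetCard (n + 1)).filter (Sparse e (blueOutside E e ic) q) := by
            ext S
            simp [Finset.mem_powersetCard, and_assoc]
          rw [hset, mul_comm]
          refine (sum_orderWeight_le e _ hL hq n).trans ?_
          exact mul_le_mul_of_nonneg_left
            (pow_le_pow_right₀ hM (Finset.mem_range.mp hn).le) (hZ0 ic)
      _ = _ := by rw [Finset.sum_const, Finset.card_range, nsmul_eq_mul, mul_assoc]
  refine (muH_le_sum _).trans ?_
  calc _ ≤ ∑ ic : V → Bool, ENNReal.ofReal (1 / 2 ^ Fintype.card V) *
        ENNReal.ofReal (G ic (bluePart e ic)) :=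
        Finset.sum_le_sum fun ic _ => mul_le_mul_right (hslice ic) _
    _ = ENNReal.ofReal (1 / 2 ^ Fintype.card V * ∑ ic, G ic (bluePart e ic)) := by
        rw [← Finset.mul_sum, ENNReal.ofReal_mul (by positivity),
          ENNReal.ofReal_sum_of_nonneg fun _ _ => hG0 _ _]
    _ ≤ _ := by
        refine ENNReal.ofReal_le_ofReal ?_
        rw [sum_bluePart_eq e G hindep]
        have hsum : ∑ ic, ∑ S ∈ e.powerset, G ic S ≤
            N * (L * q) ^ N * (2 ^ Fintype.card V * (L * q / k)) := by
          refine (Finset.sum_le_sum fun ic _ => hGsum ic).trans ?_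
          rw [← Finset.mul_sum]
          exact mul_le_mul_of_nonneg_left (sum_blueOutside_le E e hL hk hkE) (by positivity)
        calc _ ≤ 1 / 2 ^ Fintype.card V *
              (N * (L * q) ^ N * (2 ^ Fintype.card V * (L * q / k)) / 2 ^ e.card) := by gcongr
          _ = _ := by field_simp

end RedEdge

lemma eventually_log_bound : ∃ k0 : ℕ, 0 < k0 ∧ ∀ k : ℕ, k0 ≤ k → ∀ q : ℝ, 1 ≤ q →
    q ≤ 1 / 8 * Real.log k / Real.log (Real.log k) →
    3 * q ^ 2 * ⌊q⌋₊ * (Real.log (3 * q) * q) ^ ⌊q⌋₊ * Real.log (3 * q) ≤ 2 * k := by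
  have hlog : Filter.Tendsto (fun k : ℕ => Real.log k) Filter.atTop Filter.atTop :=
    Real.tendsto_log_atTop.comp tendsto_natCast_atTop_atTop
  have hexp : ∀ᶠ y : ℝ in Filter.atTop, 9 * y ^ 4 ≤ 2 * Real.exp (y / 2) := by
    have h := (Real.tendsto_exp_div_pow_atTop 4).comp
      (Filter.tendsto_id.atTop_div_const (show (0 : ℝ) < 2 by norm_num))
    filter_upwards [h.eventually_ge_atTop 72, Filter.eventually_gt_atTop 0] with y hy hy0
    simp only [Function.comp, id] at hy
    rw [le_div_iff₀ (by positivity)] at hy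
    nlinarith
  obtain ⟨k0, hk0⟩ := Filter.eventually_atTop.mp
    ((hlog.eventually hexp).and (hlog.eventually_ge_atTop (Real.exp 1)))
  refine ⟨max k0 1, by simp, fun k hk q hq1 hq => ?_⟩
  obtain ⟨hy4, hye⟩ := hk0 k (le_of_max_le_left hk)
  have hkpos : (0 : ℝ) < k := by exact_mod_cast (le_of_max_le_right hk)
  set y := Real.log k with hy
  have hy2 : 2 ≤ y := by have := Real.add_one_le_exp 1; linarith
  have hl1 : 1 ≤ Real.log y := by
    rw [Real.le_log_iff_exp_le (by linarith)]; exact hye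
  have hqy : q * Real.log y ≤ y / 8 := by
    rw [le_div_iff₀ (by linarith)] at hq; linarith
  have hqley : q ≤ y := by nlinarith
  have hN : (⌊q⌋₊ : ℝ) ≤ q := Nat.floor_le (by linarith)
  have hL0 : 0 ≤ Real.log (3 * q) := Real.log_nonneg (by linarith)
  have hL : Real.log (3 * q) ≤ 3 * q := by
    have := Real.log_le_sub_one_of_pos (show 0 < 3 * q by linarith); linarith
  have hM : Real.log (3 * q) * q ≤ y ^ 4 := by
    calc Real.log (3 * q) * q ≤ 3 * y * y := by gcongr; linarith
      _ ≤ y ^ 4 := by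
          have : 4 ≤ y * y := by nlinarith
          nlinarith [mul_le_mul_of_nonneg_right this (mul_self_nonneg y)]
  have hpow : (Real.log (3 * q) * q) ^ ⌊q⌋₊ ≤ Real.exp (y / 2) := by
    calc (Real.log (3 * q) * q) ^ ⌊q⌋₊ ≤ (y ^ 4) ^ ⌊q⌋₊ := by gcongr
      _ = Real.exp (4 * (⌊q⌋₊ * Real.log y)) := by
          rw [← pow_mul, ← Real.exp_log (show 0 < y ^ (4 * ⌊q⌋₊) by positivity), Real.log_pow]
          push_cast
          ring_nf
      _ ≤ Real.exp (y / 2) := by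
          refine Real.exp_le_exp.mpr ?_
          nlinarith
  calc 3 * q ^ 2 * ⌊q⌋₊ * (Real.log (3 * q) * q) ^ ⌊q⌋₊ * Real.log (3 * q)
      ≤ 3 * y ^ 2 * y * Real.exp (y / 2) * (3 * y) := by
        gcongr
        · exact hN.trans hqley
        · linarith
    _ = (9 * y ^ 4) * Real.exp (y / 2) := by ring
    _ ≤ (2 * Real.exp (y / 2)) * Real.exp (y / 2) := by gcongr
    _ = 2 * k := by
        rw [mul_assoc, ← Real.exp_add, add_halves, hy, Real.exp_log hkpos]

/-- Simple bound (Proposition 2.2): there are constants `δ, αA, αB, αC > 0` such that for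
all sufficiently large `k`, for every hypergraph with `s_min(H) ≥ k` and
`1 ≤ q(H) ≤ δ·log k/log log k` and every edge `e`, the probability that all of `e` gets
final color red while none of the bad events `A, B, C` occurs is at most
`1/(3·q·2^{|e|−1})`. -/
theorem red_edge_probability_simple :
    ∃ δ aA aB aC : ℝ, 0 < δ ∧ 0 < aA ∧ 0 < aB ∧ 0 < aC ∧
      ∃ k0 : ℕ, ∀ k : ℕ, k0 ≤ k →
        ∀ (V : Type) [Fintype V] [DecidableEq V] (E : Finset (Finset V)),
          (∀ f ∈ E, 2 ≤ f.card) → (∀ f ∈ E, k ≤ f.card) →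
          1 ≤ qH E → qH E ≤ δ * Real.log k / Real.log (Real.log k) →
          ∀ C : (V → Bool) → (V → ℝ) → (V → Bool),
            (∀ ic w, Function.Injective w → IsFinalColoring E ic w (C ic w)) →
            ∀ e ∈ E,
              muH V {ω : (V → Bool) × (V → ℝ) |
                  (∀ v ∈ e, C ω.1 ω.2 v = false) ∧
                  ¬ BadA E aA (qH E) ω.1 ∧ ¬ BadB E aB (qH E) ω.1 ω.2 ∧
                  ¬ BadC E aC (qH E) ω.1} ≤
                ENNReal.ofReal (1 / (3 * qH E * 2 ^ (e.card - 1))) := by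
  obtain ⟨k0, hk0, hbound⟩ := eventually_log_bound
  refine ⟨1 / 8, 1, 3, 1, by norm_num, by norm_num, by norm_num, by norm_num, k0, ?_⟩
  intro k hk V _ _ E hE hkE hq1 hq C hC e he
  have hkpos : 0 < k := hk0.trans_le hk
  have hL1 : 1 ≤ Real.log (3 * qH E) := by
    rw [Real.le_log_iff_exp_le (by linarith)]
    have := Real.exp_one_lt_d9
    linarith
  refine (muH_red_edge_le E hE hkpos hkE (by linarith) (by linarith) (by nlinarith) C hC he).trans
    (ENNReal.ofReal_le_ofReal ?_)
  have hb := hbound k hk (qH E) hq1 hq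
  have hk' : (0 : ℝ) < k := by exact_mod_cast hkpos
  have hcard : e.card = e.card - 1 + 1 := by have := hE e he; omega
  rw [show (2 : ℝ) ^ e.card = 2 ^ (e.card - 1) * 2 by rw [← pow_succ, ← hcard], mul_div_assoc',
    div_div, div_le_div_iff₀ (by positivity) (by positivity)]
  have hp : (0 : ℝ) ≤ 2 ^ (e.card - 1) := by positivity
  nlinarith [mul_le_mul_of_nonneg_left hb hp]
end

section
/- Let H=(V,E) be a hypergraph, ic : V → {blue, red} any initial coloring and w : V → (0,1) any injective weight function, and let c be the final coloring produced by the recoloring procedure. Then every initially monochromatic edge f contains a vertex v with c(v) ≠ ic(v). -/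
open Finset

/-- Every initially monochromatic edge contains a vertex whose final color differs from its
initial color. -/
theorem mono_edge_has_recolored_vertex {V : Type} [Fintype V]
    (E : Finset (Finset V)) (hE : ∀ f ∈ E, 2 ≤ f.card)
    (ic : V → Bool) (w : V → ℝ) (hw : Function.Injective w)
    (hw01 : ∀ v, w v ∈ Set.Ioo (0 : ℝ) 1)
    (c : V → Bool) (hc : IsFinalColoring E ic w c)
    (f : Finset V) (hf : f ∈ E) (hmono : Mono ic f) :
    ∃ v ∈ f, c v ≠ ic v := by
  have hne : f.Nonempty := Finset.card_pos.mp (lt_of_lt_of_le two_pos (hE f hf))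
  obtain ⟨v, hv, hmax⟩ := f.exists_max_image w hne
  by_contra! hkeep
  have hflip := (hc v).1 ⟨f, hf, hv, hmono, hmax, fun u hu _ => hkeep u hu⟩
  rw [hkeep v hv] at hflip
  simp at hflip
end

section
/- Let H=(V,E) be a hypergraph with q := q(H), and let α > 0 satisfy α·q > 1. Set p_j := ln(α·q)/j. In the random model where each vertex independently receives a uniform color from {blue, red} and a uniform weight from (0,1), the expected number of edges f that are initially monochromatic and all of whose vertices have weight smaller than 1 − p_{|f|} is less than 1/α. -/
open MeasureTheory Finset
open scoped Classical

instance isProbabilityMeasure_muBool : IsProbabilityMeasure muBool := by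
  unfold muBool; infer_instance

instance isProbabilityMeasure_muW : IsProbabilityMeasure muW :=
  ⟨by simp [muW]⟩

theorem muBool_real_singleton (b : Bool) : muBool.real {b} = 1 / 2 := by
  rw [measureReal_def, muBool, PMF.toMeasure_apply_singleton _ _ (measurableSet_singleton b)]
  simp

theorem muW_real_Iio_le (c : ℝ) : muW.real (Set.Iio c) ≤ max c 0 := by
  rw [muW, measureReal_restrict_apply measurableSet_Iio]
  have hsub : Set.Iio c ∩ Set.Ioo 0 1 ⊆ Set.Ioo 0 c := fun x hx => ⟨hx.2.1, hx.1⟩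
  calc volume.real (Set.Iio c ∩ Set.Ioo 0 1) ≤ volume.real (Set.Ioo 0 c) :=
        measureReal_mono hsub (by simp)
    _ = max c 0 := by simp [Real.volume_real_Ioo]

theorem muW_real_Iio_lt_exp {p : ℝ} (hp : 0 < p) :
    muW.real (Set.Iio (1 - p)) < Real.exp (-p) := by
  refine (muW_real_Iio_le _).trans_lt (max_lt ?_ (Real.exp_pos _))
  have := Real.add_one_lt_exp (neg_ne_zero.mpr hp.ne')
  linarith

/-- Under a product probability measure, the coordinates in `f` all lie in `S` with
probability `(μ S) ^ |f|`. -/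
theorem pi_real_forall_mem {V Ω : Type*} [Fintype V] [MeasurableSpace Ω] (μ : Measure Ω)
    [IsProbabilityMeasure μ] (f : Finset V) (S : Set Ω) :
    (Measure.pi fun _ : V => μ).real {w | ∀ v ∈ f, w v ∈ S} = μ.real S ^ f.card := by
  have hset : {w : V → Ω | ∀ v ∈ f, w v ∈ S} =
      Set.univ.pi fun v => if v ∈ f then S else Set.univ := by
    ext w
    simp only [Set.mem_ofPred_eq, Set.mem_univ_pi]
    refine forall_congr' fun v => ?_
    by_cases hv : v ∈ f <;> simp [hv]
  rw [hset, measureReal_def, Measure.pi_pi, ENNReal.toReal_prod]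
  simp [apply_ite, measureReal_def]

theorem pi_muBool_real_mono_le {V : Type} [Fintype V] (f : Finset V) :
    (Measure.pi fun _ : V => muBool).real {ic | Mono ic f} ≤ 2 ^ (1 - (f.card : ℤ)) := by
  have hsub : {ic : V → Bool | Mono ic f} ⊆
      {ic | ∀ v ∈ f, ic v ∈ ({true} : Set Bool)} ∪ {ic | ∀ v ∈ f, ic v ∈ ({false} : Set Bool)} := by
    intro ic h
    rcases f.eq_empty_or_nonempty with rfl | ⟨u, hu⟩
    · simp
    · cases hb : ic u
      · exact Or.inr fun v hv => (h v hv u hu).trans hb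
      · exact Or.inl fun v hv => (h v hv u hu).trans hb
  calc _ ≤ _ := measureReal_mono hsub
    _ ≤ _ := measureReal_union_le _ _
    _ = 2 ^ (1 - (f.card : ℤ)) := by
      rw [pi_real_forall_mem, pi_real_forall_mem, muBool_real_singleton, muBool_real_singleton,
        zpow_sub₀ two_ne_zero, zpow_one, zpow_natCast, one_div, inv_pow]
      ring

theorem measurableSet_mono {V : Type} [Fintype V] (f : Finset V) :
    MeasurableSet {ic : V → Bool | Mono ic f} :=
  (Set.toFinite _).measurableSet

theorem measurableSet_forall_mem_lt {V : Type} [Fintype V] (f : Finset V) (c : ℝ) :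
    MeasurableSet {w : V → ℝ | ∀ v ∈ f, w v < c} := by
  have hset : {w : V → ℝ | ∀ v ∈ f, w v < c} = ⋂ v ∈ f, {w | w v < c} := by
    ext; simp
  rw [hset]
  exact f.measurableSet_biInter fun v _ => measurableSet_lt (measurable_pi_apply v) measurable_const

instance isProbabilityMeasure_muH (V : Type) [Fintype V] : IsProbabilityMeasure (muH V) := by
  unfold muH; infer_instance

/-- With `p = L / |f|`, the edge `f` is monochromatic with all weights below `1 - p` with
probability less than `2 ^ (1 - |f|) * exp (-L)`. -/
theorem muH_real_mono_light_lt {V : Type} [Fintype V] {f : Finset V} (hf : 0 < f.card)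
    {L : ℝ} (hL : 0 < L) :
    (muH V).real ({ic | Mono ic f} ×ˢ {w | ∀ v ∈ f, w v < 1 - L / (f.card : ℝ)}) <
      2 ^ (1 - (f.card : ℤ)) * Real.exp (-L) := by
  have hcard : (0 : ℝ) < f.card := by exact_mod_cast hf
  have hlight : (Measure.pi fun _ : V => muW).real {w | ∀ v ∈ f, w v < 1 - L / (f.card : ℝ)} <
      Real.exp (-L) := by
    calc _ = muW.real (Set.Iio (1 - L / (f.card : ℝ))) ^ f.card := pi_real_forall_mem muW f _
      _ < Real.exp (-(L / f.card)) ^ f.card :=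
        pow_lt_pow_left₀ (muW_real_Iio_lt_exp (div_pos hL hcard)) measureReal_nonneg hf.ne'
      _ = Real.exp (-L) := by
        rw [← Real.exp_nat_mul]
        congr 1
        field_simp
  rw [muH, measureReal_prod_prod]
  exact mul_lt_mul' (pi_muBool_real_mono_le f) hlight measureReal_nonneg (by positivity)

/-- The expected number of events that occur is the sum of their probabilities. -/
theorem integral_card_filter_mem {Ω ι : Type*} [MeasurableSpace Ω] (μ : Measure Ω)
    [IsFiniteMeasure μ] (E : Finset ι) (A : ι → Set Ω)
    [∀ ω, DecidablePred fun i => ω ∈ A i] (hA : ∀ i ∈ E, MeasurableSet (A i)) :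
    ∫ ω, ((E.filter fun i => ω ∈ A i).card : ℝ) ∂μ = ∑ i ∈ E, μ.real (A i) := by
  have hcard : ∀ ω, ((E.filter fun i => ω ∈ A i).card : ℝ) =
      ∑ i ∈ E, (A i).indicator (fun _ => (1 : ℝ)) ω := fun ω => by
    simp [Set.indicator_apply]
  simp_rw [hcard]
  rw [integral_finsetSum _ fun i hi => (integrable_const 1).indicator (hA i hi)]
  exact Finset.sum_congr rfl fun i hi => integral_indicator_one (hA i hi)

/-- With `p_j := ln(α·q)/j`, the expected number of edges `f` that are initially
monochromatic and all of whose vertices have weight below `1 − p_{|f|}` is less than `1/α`,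
provided `α·q > 1`. -/
theorem expected_light_edges_lt {V : Type} [Fintype V]
    (E : Finset (Finset V)) (hE : ∀ f ∈ E, 2 ≤ f.card)
    (α : ℝ) (hα : 0 < α) (hαq : 1 < α * qH E) :
    ∫ ω : (V → Bool) × (V → ℝ),
        ((E.filter fun f => Mono ω.1 f ∧
            ∀ v ∈ f, ω.2 v < 1 - Real.log (α * qH E) / (f.card : ℝ)).card : ℝ)
        ∂(muH V) < 1 / α := by
  have hq : 0 < qH E := pos_of_mul_pos_right (one_pos.trans hαq) hα.le
  have hne : E.Nonempty := by
    rw [Finset.nonempty_iff_ne_empty]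
    rintro rfl
    simp [qH] at hq
  calc _ = ∑ f ∈ E, (muH V).real ({ic | Mono ic f} ×ˢ
          {w | ∀ v ∈ f, w v < 1 - Real.log (α * qH E) / (f.card : ℝ)}) :=
        integral_card_filter_mem (muH V) E _ fun f _ =>
          (measurableSet_mono f).prod (measurableSet_forall_mem_lt f _)
    _ < ∑ f ∈ E, (2 : ℝ) ^ (1 - (f.card : ℤ)) * Real.exp (-Real.log (α * qH E)) :=
        Finset.sum_lt_sum_of_nonempty hne fun f hf =>
          muH_real_mono_light_lt (two_pos.trans_le (hE f hf)) (Real.log_pos hαq)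
    _ = qH E * (α * qH E)⁻¹ := by
        rw [← Finset.sum_mul, Real.exp_neg, Real.exp_log (one_pos.trans hαq), qH]
    _ = 1 / α := by field_simp
end

section
/- Let J be a finite index set, r : J → ℕ, p : J → [0,∞), and let c ≥ 1 be an integer. Then the sum, over all functions (c_j)_{j∈J} with values in ℕ satisfying ∑_{j∈J} c_j = c, of ∏_{j∈J} binomial(r_j, c_j)·p_j^{c_j}, is at most (∑_{j∈J} r_j·p_j)^c / c!. -/
open Finset

/-- The multinomial theorem in divided-power form. -/
theorem sum_antidiagonalTuple_prod_pow_div_factorial {K : Type*} [Field K] [CharZero K]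
    (m c : ℕ) (x : Fin m → K) :
    ∑ g ∈ Finset.Nat.antidiagonalTuple m c, ∏ j, x j ^ g j / (Nat.factorial (g j) : K) =
      (∑ j, x j) ^ c / (Nat.factorial c : K) := by
  have hset : Finset.Nat.antidiagonalTuple m c = Finset.piAntidiag univ c := by
    ext g
    simp [Finset.Nat.mem_antidiagonalTuple]
  rw [hset, Finset.sum_pow_eq_sum_piAntidiag, Finset.sum_div]
  refine Finset.sum_congr rfl fun g hg => ?_
  have hsum : ∑ j, g j = c := (Finset.mem_piAntidiag.mp hg).1
  have hspec : (∏ j, (Nat.factorial (g j) : K)) * Nat.multinomial univ g = Nat.factorial c := by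
    rw [← hsum]
    exact_mod_cast Nat.multinomial_spec univ g
  have hprod : (∏ j, (Nat.factorial (g j) : K)) ≠ 0 :=
    Finset.prod_ne_zero_iff.mpr fun j _ => Nat.cast_ne_zero.mpr (Nat.factorial_ne_zero _)
  rw [Finset.prod_div_distrib, div_eq_div_iff hprod (Nat.cast_ne_zero.mpr c.factorial_ne_zero),
    ← hspec]
  ring

/-- For a finite index set, `r : J → ℕ`, nonnegative `p : J → ℝ` and an integer `c ≥ 1`,
the sum over all tuples `(c_j)` of naturals with `∑ c_j = c` of `∏ C(r_j, c_j) p_j^{c_j}`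
is at most `(∑ r_j p_j)^c / c!`. -/
theorem multinomial_binomial_bound (m c : ℕ) (hc : 1 ≤ c)
    (r : Fin m → ℕ) (p : Fin m → ℝ) (hp : ∀ j, 0 ≤ p j) :
    ∑ g ∈ Finset.Nat.antidiagonalTuple m c,
        ∏ j, ((r j).choose (g j) : ℝ) * p j ^ g j ≤
      (∑ j, (r j : ℝ) * p j) ^ c / (Nat.factorial c : ℝ) := by
  rw [← sum_antidiagonalTuple_prod_pow_div_factorial]
  refine Finset.sum_le_sum fun g _ => Finset.prod_le_prod
    (fun j _ => mul_nonneg (Nat.cast_nonneg _) (pow_nonneg (hp j) _)) fun j _ => ?_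
  rw [mul_pow, mul_div_right_comm]
  exact mul_le_mul_of_nonneg_right (Nat.choose_le_pow_div _ _) (pow_nonneg (hp j) _)
end
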